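/- Let $m\neq 0$ be a real constant. On the domain $\{r>0,\ \zeta+\bar\zeta>0\}$ of $\mathbb R^4$, with coordinates $(u,r,\zeta,\bar\zeta)$ ($u,r$ real, $\zeta$ complex), put $P=(\zeta+\bar\zeta)^{3/2}$, $H=-\frac{m}{r}-\frac32(\zeta+\bar\zeta)$, and $$l=\partial_r,\qquad n=\partial_u-H\,\partial_r,\qquad \mathbf m=\tfrac{P}{r}\,\partial_\zeta,\qquad \bar{\mathbf m}=\tfrac{P}{r}\,\partial_{\bar\zeta}.$$ Then $(l,n,\mathbf m,\bar{\mathbf m})$ is a null tetrad, normalized by $l\cdot n=1$, $\mathbf m\cdot\bar{\mathbf m}=-1$, of the Robinson–Trautman metric $$g=2\,dr\,du+2H\,du^2-2r^2P^{-2}\,d\zeta\,d\bar\zeta=2\,dr\,du-\Big(3(\zeta+\bar\zeta)+\frac{2m}{r}\Big)du^2-2r^2(\zeta+\bar\zeta)^{-3}\,d\zeta\,d\bar\zeta ,$$ and the following hold. 1. $g$ is Ricci-flat. 2. With the convention $(\nabla_a\nabla_b-\nabla_b\nabla_a)V^d=R_{abc}{}^dV^c$, the Weyl scalars $\Psi_0=C(l,\mathbf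 m,l,\mathbf m)$, $\Psi_1=C(l,\mathbf m,l,n)$, $\Psi_2=C(l,\mathbf m,\bar{\mathbf m},n)$, $\Psi_3=C(l,n,\bar{\mathbf m},n)$, $\Psi_4=C(\bar{\mathbf m},n,\bar{\mathbf m},n)$ are $$\Psi_0=\Psi_1=0,\quad \Psi_2=-\frac{m}{r^3},\quad \Psi_3=\frac{3(\zeta+\bar\zeta)^{3/2}}{2r^2},\quad \Psi_4=-\frac{9(\zeta+\bar\zeta)^2}{2r^2}.$$ 3. $g$ is of Petrov type II on an open dense subset of the domain: it is of type II (one double and two simple principal null directions) exactly at the points with $r(\zeta+\bar\zeta)\neq 3m$, and of type D exactly at the points with $r(\zeta+\bar\zeta)=3m$ (there are none if $m<0$). 4. Let $(o,\iota)$ be the spin dyad of the tetrad ($o_A\iota^A=1$, $l=o\bar o$, $\mathbf m=o\bar\iota$, $\bar{\mathbf m}=\iota\bar o$, $n=\iota\bar\iota$), let $\Psi_2^{1/3}$ be any continuous branch of the cube root on the domain, and let $\xi_{AA'}=\nabla^B{}_{A'}K_{AB}$, with $K_{AB}=\Psi_2^{-1/3}o_{(A}\iota_{B)}-\frac13\Psi_2^{-4/3}\Psi_3\,o_Ao_B$,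 be the projected Killing vector. Then there are cube roots $(-1)^{1/3}$ of $-1$ and $m^{1/3}$ of $m$ with $\Psi_2^{1/3}=(-1)^{1/3}m^{1/3}/r$ on the domain, and, with $(-1)^{2/3}=((-1)^{1/3})^2$ and $m^{4/3}=(m^{1/3})^4$, $$\xi^a=\frac{-3\,(-1)^{2/3}}{2\,m^{4/3}}\Big((\zeta+\bar\zeta)^3(\partial_\zeta)^a+m\,(\partial_u)^a\Big).$$ The same vector is given by the GHP expression $$\xi_a=\frac{3}{2\Psi_2^{1/3}}\big(\rho' l_a-\rho n_a-\tau' \mathbf m_a+\tau\bar{\mathbf m}_a\big)+\frac{(\eth-4\tau)\Psi_3}{2\Psi_2^{4/3}}\,l_a-\frac{(\text{þ}-4\rho)\Psi_3}{2\Psi_2^{4/3}}\,\mathbf m_a ,$$ where $\rho=\mathbf m^a\bar{\mathbf m}^b\nabla_b l_a$, $\tau=\mathbf m^an^b\nabla_bl_a$, $\rho'=\bar{\mathbf m}^a\mathbf m^b\nabla_bn_a$, $\tau'=\bar{\mathbf m}^al^b\nabla_bn_a$, $\text{þ}\Psi_3=(l^a\nabla_a+2\epsilon)\Psi_3$, $\eth\Psi_3=(\mathbf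 m^a\nabla_a+2\beta)\Psi_3$, $\epsilon=\frac12(n^al^b\nabla_bl_a+\mathbf m^al^b\nabla_b\bar{\mathbf m}_a)$ and $\beta=\frac12(n^a\mathbf m^b\nabla_bl_a+\mathbf m^a\mathbf m^b\nabla_b\bar{\mathbf m}_a)$. For the principal branch of $\Psi_2^{1/3}$ the formula for $\xi^a$ holds with principal powers $(-1)^{2/3}$, $m^{4/3}$ if $m>0$, and with the constant $-3/(2(-m)^{4/3})$ in place of $-3(-1)^{2/3}/(2m^{4/3})$ if $m<0$. -/

import Mathlib

noncomputable section

namespace RT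

/-! ### Metrics and curvature in a chart of `ℝ⁴` -/

/-- Points of the real chart, with coordinates `(u, r, x, y)`, where `ζ = x + i y`. -/
abbrev Pt := Fin 4 → ℝ

/-- The partial derivative `∂_i f` at `p`. -/
def pd {E : Type*} [NormedAddCommGroup E] [NormedSpace ℝ E] (i : Fin 4) (f : Pt → E) (p : Pt) : E :=
  fderiv ℝ f p (Pi.single i 1)

/-- A field of symmetric bilinear forms, given by its matrix of components `g_{ab}`. -/
abbrev Metric := Pt → Matrix (Fin 4) (Fin 4) ℝ

/-- Christoffel symbols `Γ^a_{bc}` of the Levi-Civita connection. -/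
def christoffel (g : Metric) (a b c : Fin 4) (p : Pt) : ℝ :=
  1 / 2 * ∑ d, (g p)⁻¹ a d *
    (pd b (fun q => g q d c) p + pd c (fun q => g q d b) p - pd d (fun q => g q b c) p)

/-- `R_{abc}{}^d`, with the sign convention
`(∇_a ∇_b − ∇_b ∇_a) V^d = R_{abc}{}^d V^c`. -/
def riemannUp (g : Metric) (a b c d : Fin 4) (p : Pt) : ℝ :=
  pd a (christoffel g d b c) p - pd b (christoffel g d a c) p
    + ∑ e, (christoffel g d a e p * christoffel g e b c p
        - christoffel g d b e p * christoffel g e a c p)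

/-- `R_{abcd}`. -/
def riemann (g : Metric) (a b c d : Fin 4) (p : Pt) : ℝ :=
  ∑ e, riemannUp g a b c e p * g p e d

/-- The Ricci tensor `R_{ab} = R_{acb}{}^c`. -/
def ricci (g : Metric) (a b : Fin 4) (p : Pt) : ℝ := ∑ c, riemannUp g a c b c p

/-- The scalar curvature `g^{ab} R_{ab}`. -/
def scalarCurv (g : Metric) (p : Pt) : ℝ := ∑ a, ∑ b, (g p)⁻¹ a b * ricci g a b p

/-- The Weyl tensor `C_{abcd}` in dimension four. -/
def weyl (g : Metric) (a b c d : Fin 4) (p : Pt) : ℝ :=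
  riemann g a b c d p
    - 1 / 2 * (g p a c * ricci g b d p - g p a d * ricci g b c p
        + g p b d * ricci g a c p - g p b c * ricci g a d p)
    + scalarCurv g p / 6 * (g p a c * g p b d - g p a d * g p b c)

/-! ### Complex vector fields and null tetrads -/

/-- A complex vector at a point, by its components in the basis `∂_u, ∂_r, ∂_x, ∂_y`. -/
abbrev CVec := Fin 4 → ℂ

/-- The complex bilinear extension of the metric. -/
def ip (g : Metric) (p : Pt) (v w : CVec) : ℂ := ∑ a, ∑ b, (g p a b : ℂ) * v a * w b

/-- The derivative `V^a ∂_a f` of a scalar field. -/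
def dirD (V : Pt → CVec) (f : Pt → ℂ) (p : Pt) : ℂ := ∑ a, V p a * pd a f p

/-- The Levi-Civita derivative `V^b ∇_b W^a`. -/
def covD (g : Metric) (V W : Pt → CVec) (p : Pt) : CVec := fun a =>
  dirD V (fun q => W q a) p + ∑ b, ∑ c, (christoffel g a b c p : ℂ) * V p b * W p c

/-- A quadruple of complex vector fields `(l, n, m, m̄)`. -/
structure Tetrad where
  l : Pt → CVec
  n : Pt → CVec
  m : Pt → CVec
  mb : Pt → CVec

/-- `(l, n, m, m̄)` is at `p` a normalized null tetrad of `g`: `l`, `n` real, `m̄` the conjugate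
of `m`, `l·n = 1`, `m·m̄ = −1`, all other products zero. -/
def Tetrad.IsNullAt (t : Tetrad) (g : Metric) (p : Pt) : Prop :=
  (∀ a, starRingEnd ℂ (t.l p a) = t.l p a) ∧ (∀ a, starRingEnd ℂ (t.n p a) = t.n p a) ∧
  (∀ a, starRingEnd ℂ (t.m p a) = t.mb p a) ∧
  ip g p (t.l p) (t.n p) = 1 ∧ ip g p (t.m p) (t.mb p) = -1 ∧
  ip g p (t.l p) (t.l p) = 0 ∧ ip g p (t.n p) (t.n p) = 0 ∧
  ip g p (t.m p) (t.m p) = 0 ∧ ip g p (t.mb p) (t.mb p) = 0 ∧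
  ip g p (t.l p) (t.m p) = 0 ∧ ip g p (t.l p) (t.mb p) = 0 ∧
  ip g p (t.n p) (t.m p) = 0 ∧ ip g p (t.n p) (t.mb p) = 0

/-- `C_{abcd} v₁^a v₂^b v₃^c v₄^d`. -/
def weylC (g : Metric) (p : Pt) (v₁ v₂ v₃ v₄ : CVec) : ℂ :=
  ∑ a, ∑ b, ∑ c, ∑ d, (weyl g a b c d p : ℂ) * v₁ a * v₂ b * v₃ c * v₄ d

/-- The Weyl scalars `Ψ₀, …, Ψ₄` of a tetrad; these are the dyad components of the Weyl spinor
`Ψ_{ABCD}` in `C_{abcd} = Ψ_{ABCD} ε̄_{A'B'} ε̄_{C'D'} + c.c.` -/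
def Psi (g : Metric) (t : Tetrad) (i : Fin 5) (p : Pt) : ℂ :=
  ![weylC g p (t.l p) (t.m p) (t.l p) (t.m p),
    weylC g p (t.l p) (t.m p) (t.l p) (t.n p),
    weylC g p (t.l p) (t.m p) (t.mb p) (t.n p),
    weylC g p (t.l p) (t.n p) (t.mb p) (t.n p),
    weylC g p (t.mb p) (t.n p) (t.mb p) (t.n p)] i

/-! ### Petrov types -/

/-- The binary quartic `Ψ_{ABCD} η^A η^B η^C η^D` at `η = x o + y ι`. -/
def weylQuartic (Ψ : Fin 5 → ℂ) (x y : ℂ) : ℂ :=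
  Ψ 0 * x ^ 4 + 4 * Ψ 1 * x ^ 3 * y + 6 * Ψ 2 * x ^ 2 * y ^ 2 + 4 * Ψ 3 * x * y ^ 3 + Ψ 4 * y ^ 4

/-- Type II: one double and two simple principal spinors, pairwise non-proportional. -/
def IsTypeII (Ψ : Fin 5 → ℂ) : Prop :=
  ∃ α β γ : Fin 2 → ℂ,
    α 0 * β 1 - α 1 * β 0 ≠ 0 ∧ α 0 * γ 1 - α 1 * γ 0 ≠ 0 ∧ β 0 * γ 1 - β 1 * γ 0 ≠ 0 ∧
    ∀ x y, weylQuartic Ψ x y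
      = (α 0 * x + α 1 * y) ^ 2 * (β 0 * x + β 1 * y) * (γ 0 * x + γ 1 * y)

/-- Type D: two double, non-proportional principal spinors. -/
def IsTypeD (Ψ : Fin 5 → ℂ) : Prop :=
  ∃ α β : Fin 2 → ℂ, α 0 * β 1 - α 1 * β 0 ≠ 0 ∧
    ∀ x y, weylQuartic Ψ x y = (α 0 * x + α 1 * y) ^ 2 * (β 0 * x + β 1 * y) ^ 2

/-! ### Spinors in the dyad `(o, ι)` of a tetrad

The dyad is normalized by `o_A ι^A = 1`, with `l = o ō`, `m = o ῑ`, `m̄ = ι ō`, `n = ι ῑ`. The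
dyad indices `0`, `1` stand for contraction with `o^A`, `ι^A`. Indices are raised by
`φ^A = ε^{AB} φ_B`. -/

/-- The components `ε_{AB}`, and also `ε^{AB}`, in the dyad. -/
def eps : Matrix (Fin 2) (Fin 2) ℂ := !![0, 1; -1, 0]

/-- The vector `e_{AA'}` of the tetrad. -/
def frame (t : Tetrad) (A A' : Fin 2) : Pt → CVec :=
  !![t.l, t.m; t.mb, t.n] A A'

/-- The component `v^{AA'}` of `v = v^{AA'} e_{AA'}`, that is
`ε^{AB} ε̄^{A'B'} g(e_{BB'}, v)`. -/
def coframe (g : Metric) (t : Tetrad) (A A' : Fin 2) (p : Pt) (v : CVec) : ℂ :=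
  ∑ B, ∑ B', eps A B * eps A' B' * ip g p (frame t B B' p) v

/-- The coefficients `ω_B{}^C` of the spin connection along `V`, so that
`V^a ∇_a ε_B = ω_B{}^C ε_C` for the dyad `ε_0 = o`, `ε_1 = ι`. The spin connection is the
connection preserving `ε_{AB}` that induces the Levi-Civita connection,
`V^a ∇_a e_{BB'} = ω_B{}^C e_{CB'} + ω̄_{B'}{}^{C'} e_{BC'}`; as `ω` is trace-free, contraction
over the primed index gives `2 ω_B{}^C`. -/
def spinConn (g : Metric) (t : Tetrad) (V : Pt → CVec) (B C : Fin 2) (p : Pt) : ℂ :=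
  1 / 2 * ∑ B', coframe g t C B' p (covD g V (frame t B B') p)

/-- The dyad components of `∇_{DA'} K_{AB}`, for a spinor field with dyad components `K_{AB}`. -/
def nablaK (g : Metric) (t : Tetrad) (K : Fin 2 → Fin 2 → Pt → ℂ) (D A' A B : Fin 2) (p : Pt) : ℂ :=
  dirD (frame t D A') (K A B) p
    - ∑ C, (spinConn g t (frame t D A') A C p * K C B p
        + spinConn g t (frame t D A') B C p * K A C p)

/-- Dyad components of `∇^B{}_{A'} K_{AB} = ε^{BD} ∇_{DA'} K_{AB}`. -/
def divK (g : Metric) (t : Tetrad) (K : Fin 2 → Fin 2 → Pt → ℂ) (A A' : Fin 2) (p : Pt) : ℂ :=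
  ∑ B, ∑ D, eps B D * nablaK g t K D A' A B p

/-- The components of `o_A` : `o_A o^A = 0`, `o_A ι^A = 1`. -/
def oLow : Fin 2 → ℂ := ![0, 1]

/-- The components of `ι_A` : `ι_A o^A = −1`, `ι_A ι^A = 0`. -/
def iotaLow : Fin 2 → ℂ := ![-1, 0]

/-- The projected Killing spinor
`K_{AB} = Ψ₂^{-1/3} o_{(A} ι_{B)} − (1/3) Ψ₂^{-4/3} Ψ₃ o_A o_B`, where `ψ` is the chosen branch
of `Ψ₂^{1/3}`. -/
def projKS (g : Metric) (t : Tetrad) (ψ : Pt → ℂ) (A B : Fin 2) (p : Pt) : ℂ :=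
  (ψ p)⁻¹ * ((oLow A * iotaLow B + oLow B * iotaLow A) / 2)
    - 1 / 3 * (ψ p ^ 4)⁻¹ * Psi g t 3 p * (oLow A * oLow B)

/-- The projected Killing vector `ξ^a` of `ξ_{AA'} = ∇^B{}_{A'} K_{AB}`. -/
def projKV (g : Metric) (t : Tetrad) (ψ : Pt → ℂ) (p : Pt) : CVec :=
  ∑ A, ∑ A', (∑ B, ∑ B', eps A B * eps A' B' * divK g t (projKS g t ψ) B B' p) • frame t A A' p

/-! ### The GHP expression of the projected Killing vector -/

/-- `ρ = m^a m̄^b ∇_b l_a`. -/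
def rho (g : Metric) (t : Tetrad) (p : Pt) : ℂ := ip g p (t.m p) (covD g t.mb t.l p)

/-- `τ = m^a n^b ∇_b l_a`. -/
def tau (g : Metric) (t : Tetrad) (p : Pt) : ℂ := ip g p (t.m p) (covD g t.n t.l p)

/-- `ρ' = m̄^a m^b ∇_b n_a`. -/
def rho' (g : Metric) (t : Tetrad) (p : Pt) : ℂ := ip g p (t.mb p) (covD g t.m t.n p)

/-- `τ' = m̄^a l^b ∇_b n_a`. -/
def tau' (g : Metric) (t : Tetrad) (p : Pt) : ℂ := ip g p (t.mb p) (covD g t.l t.n p)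

/-- `ε = ½ (n^a l^b ∇_b l_a + m^a l^b ∇_b m̄_a)`. -/
def epsilonSC (g : Metric) (t : Tetrad) (p : Pt) : ℂ :=
  1 / 2 * (ip g p (t.n p) (covD g t.l t.l p) + ip g p (t.m p) (covD g t.l t.mb p))

/-- `β = ½ (n^a m^b ∇_b l_a + m^a m^b ∇_b m̄_a)`. -/
def betaSC (g : Metric) (t : Tetrad) (p : Pt) : ℂ :=
  1 / 2 * (ip g p (t.n p) (covD g t.m t.l p) + ip g p (t.m p) (covD g t.m t.mb p))

/-- `þ f = (l^a ∂_a − k ε) f` on scalars of weight `{k, 0}`. -/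
def tho (g : Metric) (t : Tetrad) (k : ℤ) (f : Pt → ℂ) (p : Pt) : ℂ :=
  dirD t.l f p - (k : ℂ) * epsilonSC g t p * f p

/-- `ð f = (m^a ∂_a − k β) f` on scalars of weight `{k, 0}`. -/
def edt (g : Metric) (t : Tetrad) (k : ℤ) (f : Pt → ℂ) (p : Pt) : ℂ :=
  dirD t.m f p - (k : ℂ) * betaSC g t p * f p

/-- The vector
`3/(2Ψ₂^{1/3}) (ρ' l − ρ n − τ' m + τ m̄) + (ð−4τ)Ψ₃/(2Ψ₂^{4/3}) l − (þ−4ρ)Ψ₃/(2Ψ₂^{4/3}) m`,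
where `Ψ₃` has weight `{−2, 0}` and `ψ` is the chosen branch of `Ψ₂^{1/3}`. -/
def projKVGHP (g : Metric) (t : Tetrad) (ψ : Pt → ℂ) (p : Pt) : CVec :=
  (3 / (2 * ψ p)) • (rho' g t p • t.l p - rho g t p • t.n p - tau' g t p • t.m p
      + tau g t p • t.mb p)
    + ((edt g t (-2) (Psi g t 3) p - 4 * tau g t p * Psi g t 3 p) / (2 * ψ p ^ 4)) • t.l p
    - ((tho g t (-2) (Psi g t 3) p - 4 * rho g t p * Psi g t 3 p) / (2 * ψ p ^ 4)) • t.m p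

/-! ### Robinson–Trautman metrics -/

/-- The coordinate domain `r > 0`, `ζ + ζ̄ > 0`. -/
def domain : Set Pt := {p | 0 < p 1 ∧ 0 < 2 * p 2}

/-- The coordinate vector `∂_u`. -/
def dU : CVec := ![1, 0, 0, 0]

/-- The coordinate vector `∂_r`. -/
def dR : CVec := ![0, 1, 0, 0]

/-- `∂_ζ = ½ (∂_x − i ∂_y)`. -/
def dZ : CVec := ![0, 0, 1 / 2, -Complex.I / 2]

/-- `∂_ζ̄ = ½ (∂_x + i ∂_y)`. -/
def dZb : CVec := ![0, 0, 1 / 2, Complex.I / 2]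

/-- `2 dr du + 2 H du² − 2 r² P^{-2} dζ dζ̄`, where `dζ dζ̄ = dx² + dy²`. -/
def rtMetric (P H : Pt → ℝ) : Metric := fun p =>
  !![2 * H p, 1, 0, 0;
     1, 0, 0, 0;
     0, 0, -2 * p 1 ^ 2 * (P p ^ 2)⁻¹, 0;
     0, 0, 0, -2 * p 1 ^ 2 * (P p ^ 2)⁻¹]

/-- `l = ∂_r`, `n = ∂_u − H ∂_r`, `m = (P/r) ∂_ζ`, `m̄ = (P/r) ∂_ζ̄`. -/
def rtTetrad (P H : Pt → ℝ) : Tetrad where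
  l := fun _ => dR
  n := fun p => dU - (H p : ℂ) • dR
  m := fun p => ((P p / p 1 : ℝ) : ℂ) • dZ
  mb := fun p => ((P p / p 1 : ℝ) : ℂ) • dZb

/-- `ζ + ζ̄`. -/
def zz (p : Pt) : ℝ := 2 * p 2

/-- `P = (ζ + ζ̄)^{3/2}`. -/
def P2 (p : Pt) : ℝ := zz p ^ (3 / 2 : ℝ)

/-- `H = −m/r − (3/2)(ζ + ζ̄)`. -/
def H2 (m : ℝ) (p : Pt) : ℝ := -m / p 1 - 3 / 2 * zz p

/-- `2 dr du − (3(ζ+ζ̄) + 2m/r) du² − 2 r² (ζ+ζ̄)^{-3} dζ dζ̄`. -/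
def g2 (m : ℝ) : Metric := fun p =>
  !![-(3 * zz p + 2 * m / p 1), 1, 0, 0;
     1, 0, 0, 0;
     0, 0, -2 * p 1 ^ 2 * (zz p ^ 3)⁻¹, 0;
     0, 0, 0, -2 * p 1 ^ 2 * (zz p ^ 3)⁻¹]

/-- The tetrad of the type II solution. -/
def t2 (m : ℝ) : Tetrad := rtTetrad P2 (H2 m)

/-- `(ζ+ζ̄)³ ∂_ζ + m ∂_u`. -/
def X2 (m : ℝ) (p : Pt) : CVec := ((zz p ^ 3 : ℝ) : ℂ) • dZ + (m : ℂ) • dU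

end RT

end

noncomputable section

namespace RT

/-! ### Derivatives of functions of `r` and `x` -/

/-- `f` is differentiable at `p`, with `∂_r f = a`, `∂_x f = b`, `∂_u f = ∂_y f = 0`. -/
def HasGrad (f : Pt → ℝ) (a b : ℝ) (p : Pt) : Prop :=
  HasFDerivAt f (a • ContinuousLinearMap.proj (R := ℝ) (φ := fun _ : Fin 4 => ℝ) 1
    + b • ContinuousLinearMap.proj (R := ℝ) (φ := fun _ : Fin 4 => ℝ) 2) p

theorem HasGrad.pd_eq {f : Pt → ℝ} {a b : ℝ} {p : Pt} (h : HasGrad f a b p) (i : Fin 4) :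
    pd i f p = ![0, a, b, 0] i := by
  unfold pd
  rw [HasFDerivAt.fderiv h]
  fin_cases i <;> simp

theorem HasGrad.pd_ofReal_mul {f : Pt → ℝ} {a b : ℝ} {p : Pt} (h : HasGrad f a b p) (k : ℂ)
    (i : Fin 4) : pd i (fun q => (f q : ℂ) * k) p = (![0, a, b, 0] i : ℝ) * k := by
  have h1 : HasFDerivAt (fun q => (f q : ℂ)) _ p := Complex.ofRealCLM.hasFDerivAt.comp p h
  have h2 := h1.mul_const k
  unfold pd
  rw [h2.fderiv]
  fin_cases i <;> simp [mul_comm]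

theorem HasGrad.const (c : ℝ) (p : Pt) : HasGrad (fun _ => c) 0 0 p := by
  unfold HasGrad
  exact (hasFDerivAt_const c p).congr_fderiv (by simp)

theorem HasGrad.add {f g : Pt → ℝ} {a b a' b' : ℝ} {p : Pt} (hf : HasGrad f a b p)
    (hg : HasGrad g a' b' p) : HasGrad (fun q => f q + g q) (a + a') (b + b') p := by
  unfold HasGrad at *
  exact (HasFDerivAt.add hf hg).congr_fderiv (by ext; simp; ring)

theorem HasGrad.mul {f g : Pt → ℝ} {a b a' b' : ℝ} {p : Pt} (hf : HasGrad f a b p)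
    (hg : HasGrad g a' b' p) :
    HasGrad (fun q => f q * g q) (f p * a' + g p * a) (f p * b' + g p * b) p := by
  unfold HasGrad at *
  exact (HasFDerivAt.mul hf hg).congr_fderiv (by ext; simp; ring)

theorem HasGrad.of_r {φ : ℝ → ℝ} {d : ℝ} {p : Pt} (h : HasDerivAt φ d (p 1)) :
    HasGrad (fun q => φ (q 1)) d 0 p := by
  unfold HasGrad
  have h1 : HasFDerivAt (fun q : Pt => q 1)
    (ContinuousLinearMap.proj (R := ℝ) (φ := fun _ : Fin 4 => ℝ) 1) p :=
    (ContinuousLinearMap.proj (R := ℝ) (φ := fun _ : Fin 4 => ℝ) 1).hasFDerivAt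
  exact (h.comp_hasFDerivAt p h1).congr_fderiv (by ext; simp)

theorem HasGrad.of_zz {φ : ℝ → ℝ} {d : ℝ} {p : Pt} (h : HasDerivAt φ d (zz p)) :
    HasGrad (fun q => φ (zz q)) 0 (2 * d) p := by
  unfold HasGrad
  have h1 : HasFDerivAt (fun q : Pt => zz q)
    ((2 : ℝ) • ContinuousLinearMap.proj (R := ℝ) (φ := fun _ : Fin 4 => ℝ) 2) p := by
    have := ((ContinuousLinearMap.proj (R := ℝ) (φ := fun _ : Fin 4 => ℝ) 2).hasFDerivAt
      (x := p)).const_mul 2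
    exact this
  exact (h.comp_hasFDerivAt p h1).congr_fderiv (by ext; simp; ring)

theorem HasGrad.congr {f g : Pt → ℝ} {a b a' b' : ℝ} {p : Pt} (hf : HasGrad f a b p)
    (hfg : ∀ q, g q = f q) (ha : a' = a) (hb : b' = b) : HasGrad g a' b' p := by
  obtain rfl : g = f := funext hfg
  subst ha hb
  exact hf

/-- The gradient of a Laurent monomial in `r` and `ζ + ζ̄`. -/
theorem HasGrad.monomial (k : ℝ) (i j : ℤ) {p : Pt} (hr : p 1 ≠ 0) (hs : zz p ≠ 0) :
    HasGrad (fun q => k * (q 1 ^ i * zz q ^ j)) (k * (i * p 1 ^ (i - 1) * zz p ^ j))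
      (k * (p 1 ^ i * (2 * (j * zz p ^ (j - 1))))) p := by
  have h1 := HasGrad.of_r (hasDerivAt_zpow i (p 1) (Or.inl hr))
  have h2 := HasGrad.of_zz (hasDerivAt_zpow j (zz p) (Or.inl hs))
  refine ((HasGrad.const k p).mul (h1.mul h2)).congr (fun q => rfl) ?_ ?_ <;> ring

/-! ### The domain -/

theorem isOpen_domain : IsOpen domain := by
  refine (isOpen_lt continuous_const (continuous_apply 1)).inter
    (isOpen_lt continuous_const (continuous_const.mul (continuous_apply 2)))

theorem domain_mem_nhds {p : Pt} (hp : p ∈ domain) : domain ∈ nhds p :=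
  isOpen_domain.mem_nhds hp

theorem r_pos {p : Pt} (hp : p ∈ domain) : 0 < p 1 := hp.1

theorem zz_pos {p : Pt} (hp : p ∈ domain) : 0 < zz p := hp.2

theorem pd_congr {E : Type*} [NormedAddCommGroup E] [NormedSpace ℝ E] {f g : Pt → E}
    {p : Pt} (hp : p ∈ domain) (h : ∀ q ∈ domain, f q = g q) (i : Fin 4) : pd i f p = pd i g p := by
  unfold pd
  rw [Filter.EventuallyEq.fderiv_eq (Filter.eventually_of_mem (domain_mem_nhds hp) h)]

theorem P2_sq {p : Pt} (hp : p ∈ domain) : P2 p ^ 2 = zz p ^ 3 := by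
  unfold P2
  rw [← Real.rpow_natCast, ← Real.rpow_mul (zz_pos hp).le, ← Real.rpow_natCast]
  norm_num

theorem hasGrad_P2 {p : Pt} (hp : p ∈ domain) : HasGrad P2 0 (3 * P2 p / zz p) p := by
  have hs := zz_pos hp
  have h := HasGrad.of_zz (Real.hasDerivAt_rpow_const (x := zz p) (p := 3 / 2) (Or.inl hs.ne'))
  refine h.congr (fun q => rfl) rfl ?_
  rw [Real.rpow_sub_one hs.ne']
  simp only [P2]
  ring

/-! ### The Levi-Civita connection -/

theorem hasGrad_guu (m : ℝ) {p : Pt} (hp : p ∈ domain) :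
    HasGrad (fun q => -(3 * zz q + 2 * m / q 1)) (2 * m / p 1 ^ 2) (-6) p := by
  have hr := (r_pos hp).ne'
  have hs := (zz_pos hp).ne'
  refine ((HasGrad.monomial (-3) 0 1 hr hs).add (HasGrad.monomial (-2 * m) (-1) 0 hr hs)).congr
    (fun q => ?_) ?_ ?_
  · simp; ring
  · simp; norm_cast
  · norm_num

theorem hasGrad_gxx {p : Pt} (hp : p ∈ domain) :
    HasGrad (fun q => -2 * q 1 ^ 2 * (zz q ^ 3)⁻¹) (-4 * p 1 / zz p ^ 3)
      (12 * p 1 ^ 2 / zz p ^ 4) p := by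
  have hr := (r_pos hp).ne'
  have hs := (zz_pos hp).ne'
  refine (HasGrad.monomial (-2) 2 (-3) hr hs).congr (fun q => ?_) ?_ ?_
  · rw [zpow_neg]; norm_cast; ring
  · norm_num [zpow_neg]; norm_cast; ring
  · norm_num [zpow_neg]; norm_cast; ring

/-- The inverse metric `g^{ab}`. -/
def g2inv (m r s : ℝ) : Matrix (Fin 4) (Fin 4) ℝ :=
  !![0, 1, 0, 0;
     1, 3 * s + 2 * m / r, 0, 0;
     0, 0, -s ^ 3 / (2 * r ^ 2), 0;
     0, 0, 0, -s ^ 3 / (2 * r ^ 2)]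

theorem g2_inv (m : ℝ) {p : Pt} (hp : p ∈ domain) : (g2 m p)⁻¹ = g2inv m (p 1) (zz p) := by
  have hr := (r_pos hp).ne'
  have hs := (zz_pos hp).ne'
  apply Matrix.inv_eq_right_inv
  ext i j
  fin_cases i <;> fin_cases j <;>
    simp [g2, g2inv, Matrix.mul_apply, Fin.sum_univ_four] <;> field_simp

/-- The derivatives `∂_i g_{ab}`. -/
def dg2 (m r s : ℝ) : Fin 4 → Fin 4 → Fin 4 → ℝ
  | 1, 0, 0 => 2 * m / r ^ 2
  | 1, 2, 2 => -4 * r / s ^ 3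
  | 1, 3, 3 => -4 * r / s ^ 3
  | 2, 0, 0 => -6
  | 2, 2, 2 => 12 * r ^ 2 / s ^ 4
  | 2, 3, 3 => 12 * r ^ 2 / s ^ 4
  | _, _, _ => 0

theorem pd_g2 (m : ℝ) {p : Pt} (hp : p ∈ domain) (i a b : Fin 4) :
    pd i (fun q => g2 m q a b) p = dg2 m (p 1) (zz p) i a b := by
  have h : HasGrad (fun q => g2 m q a b) (dg2 m (p 1) (zz p) 1 a b)
      (dg2 m (p 1) (zz p) 2 a b) p := by
    have h0 := hasGrad_guu m hp
    have h1 := hasGrad_gxx hp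
    have hc := fun k => HasGrad.const k p
    fin_cases a <;> fin_cases b <;>
      simp [g2, dg2, -neg_add_rev, -neg_mul, h0, h1, hc]
  rw [h.pd_eq]
  fin_cases i
  · simp [dg2]
  · rfl
  · rfl
  · simp [dg2]

/-- The Christoffel symbols `Γ^a_{bc}`. -/
def gam (m r s : ℝ) : Fin 4 → Fin 4 → Fin 4 → ℝ
  | 0, 0, 0 => -m / r ^ 2
  | 0, 2, 2 => 2 * r / s ^ 3
  | 0, 3, 3 => 2 * r / s ^ 3
  | 1, 0, 0 => -(3 * m * s / r ^ 2 + 2 * m ^ 2 / r ^ 3)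
  | 1, 0, 1 => m / r ^ 2
  | 1, 1, 0 => m / r ^ 2
  | 1, 0, 2 => -3
  | 1, 2, 0 => -3
  | 1, 2, 2 => 6 * r / s ^ 2 + 4 * m / s ^ 3
  | 1, 3, 3 => 6 * r / s ^ 2 + 4 * m / s ^ 3
  | 2, 0, 0 => -3 * s ^ 3 / (2 * r ^ 2)
  | 2, 1, 2 => 1 / r
  | 2, 2, 1 => 1 / r
  | 2, 2, 2 => -3 / s
  | 2, 3, 3 => 3 / s
  | 3, 1, 3 => 1 / r
  | 3, 3, 1 => 1 / r
  | 3, 2, 3 => -3 / s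
  | 3, 3, 2 => -3 / s
  | _, _, _ => 0

set_option maxHeartbeats 2000000 in
theorem christoffel_g2 (m : ℝ) {p : Pt} (hp : p ∈ domain) (a b c : Fin 4) :
    christoffel (g2 m) a b c p = gam m (p 1) (zz p) a b c := by
  have hr := (r_pos hp).ne'
  have hs := (zz_pos hp).ne'
  unfold christoffel
  simp only [pd_g2 m hp, g2_inv m hp, Fin.sum_univ_four]
  generalize zz p = s at *
  generalize p 1 = r at *
  fin_cases a <;> fin_cases b <;> fin_cases c <;>
    simp [gam, g2inv, dg2] <;> field_simp <;> ring

/-- The derivatives `∂_r Γ^a_{bc}`. -/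
def dgamR (m r s : ℝ) : Fin 4 → Fin 4 → Fin 4 → ℝ
  | 0, 0, 0 => 2 * m / r ^ 3
  | 0, 2, 2 => 2 / s ^ 3
  | 0, 3, 3 => 2 / s ^ 3
  | 1, 0, 0 => 6 * m * s / r ^ 3 + 6 * m ^ 2 / r ^ 4
  | 1, 0, 1 => -2 * m / r ^ 3
  | 1, 1, 0 => -2 * m / r ^ 3
  | 1, 2, 2 => 6 / s ^ 2
  | 1, 3, 3 => 6 / s ^ 2
  | 2, 0, 0 => 3 * s ^ 3 / r ^ 3
  | 2, 1, 2 => -1 / r ^ 2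
  | 2, 2, 1 => -1 / r ^ 2
  | 3, 1, 3 => -1 / r ^ 2
  | 3, 3, 1 => -1 / r ^ 2
  | _, _, _ => 0

/-- The derivatives `∂_x Γ^a_{bc}`. -/
def dgamX (m r s : ℝ) : Fin 4 → Fin 4 → Fin 4 → ℝ
  | 0, 2, 2 => -12 * r / s ^ 4
  | 0, 3, 3 => -12 * r / s ^ 4
  | 1, 0, 0 => -6 * m / r ^ 2
  | 1, 2, 2 => -24 * r / s ^ 3 - 24 * m / s ^ 4
  | 1, 3, 3 => -24 * r / s ^ 3 - 24 * m / s ^ 4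
  | 2, 0, 0 => -9 * s ^ 2 / r ^ 2
  | 2, 2, 2 => 6 / s ^ 2
  | 2, 3, 3 => -6 / s ^ 2
  | 3, 2, 3 => 6 / s ^ 2
  | 3, 3, 2 => 6 / s ^ 2
  | _, _, _ => 0

/-- The derivatives `∂_i Γ^a_{bc}`. -/
def dgam (m r s : ℝ) (i a b c : Fin 4) : ℝ :=
  ![0, dgamR m r s a b c, dgamX m r s a b c, 0] i

set_option maxHeartbeats 2000000 in
theorem hasGrad_gam (m : ℝ) {p : Pt} (hp : p ∈ domain) (a b c : Fin 4) :
    HasGrad (fun q => gam m (q 1) (zz q) a b c) (dgamR m (p 1) (zz p) a b c)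
      (dgamX m (p 1) (zz p) a b c) p := by
  have hr := (r_pos hp).ne'
  have hs := (zz_pos hp).ne'
  have mono := fun (k : ℝ) (i j : ℤ) => HasGrad.monomial k i j hr hs
  have h1 : HasGrad (fun q => -m / q 1 ^ 2) (2 * m / p 1 ^ 3) 0 p := by
    refine (mono (-m) (-2) 0).congr (fun q => ?_) ?_ ?_ <;> norm_num [zpow_neg] <;> norm_cast <;>
      ring
  have h2 : HasGrad (fun q => 2 * q 1 / zz q ^ 3) (2 / zz p ^ 3) (-12 * p 1 / zz p ^ 4) p := by
    refine (mono 2 1 (-3)).congr (fun q => ?_) ?_ ?_ <;> norm_num [zpow_neg] <;> norm_cast <;> ring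
  have h3 : HasGrad (fun q => -(3 * m * zz q / q 1 ^ 2 + 2 * m ^ 2 / q 1 ^ 3))
      (6 * m * zz p / p 1 ^ 3 + 6 * m ^ 2 / p 1 ^ 4) (-6 * m / p 1 ^ 2) p := by
    refine ((mono (-3 * m) (-2) 1).add (mono (-2 * m ^ 2) (-3) 0)).congr (fun q => ?_) ?_ ?_ <;>
      norm_num [zpow_neg] <;> norm_cast <;> ring
  have h4 : HasGrad (fun q => m / q 1 ^ 2) (-2 * m / p 1 ^ 3) 0 p := by
    refine (mono m (-2) 0).congr (fun q => ?_) ?_ ?_ <;> norm_num [zpow_neg] <;> norm_cast <;> ring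
  have h5 : HasGrad (fun q => 6 * q 1 / zz q ^ 2 + 4 * m / zz q ^ 3) (6 / zz p ^ 2)
      (-24 * p 1 / zz p ^ 3 - 24 * m / zz p ^ 4) p := by
    refine ((mono 6 1 (-2)).add (mono (4 * m) 0 (-3))).congr (fun q => ?_) ?_ ?_ <;>
      norm_num [zpow_neg] <;> norm_cast <;> ring
  have h6 : HasGrad (fun q => -3 * zz q ^ 3 / (2 * q 1 ^ 2)) (3 * zz p ^ 3 / p 1 ^ 3)
      (-9 * zz p ^ 2 / p 1 ^ 2) p := by
    refine (mono (-3 / 2) (-2) 3).congr (fun q => ?_) ?_ ?_ <;>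
      norm_num [zpow_neg] <;> norm_cast <;> ring
  have h7 : HasGrad (fun q => 1 / q 1) (-1 / p 1 ^ 2) 0 p := by
    refine (mono 1 (-1) 0).congr (fun q => ?_) ?_ ?_ <;> norm_num [zpow_neg, zpow_ofNat] <;> ring
  have h8 : HasGrad (fun q => -3 / zz q) 0 (6 / zz p ^ 2) p := by
    refine (mono (-3) 0 (-1)).congr (fun q => ?_) ?_ ?_ <;> norm_num [zpow_neg, zpow_ofNat] <;> ring
  have h9 : HasGrad (fun q => 3 / zz q) 0 (-6 / zz p ^ 2) p := by
    refine (mono 3 0 (-1)).congr (fun q => ?_) ?_ ?_ <;> norm_num [zpow_neg, zpow_ofNat] <;> ring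
  have hc := fun k => HasGrad.const k p
  fin_cases a <;> fin_cases b <;> fin_cases c <;>
    simp [gam, dgamR, dgamX, -neg_add_rev, -neg_mul, -one_div, h1, h2, h3, h4, h5, h6, h7, h8,
      h9, hc]

theorem pd_christoffel_g2 (m : ℝ) {p : Pt} (hp : p ∈ domain) (i a b c : Fin 4) :
    pd i (christoffel (g2 m) a b c) p = dgam m (p 1) (zz p) i a b c := by
  rw [pd_congr hp (fun q hq => christoffel_g2 m hq a b c) i, (hasGrad_gam m hp a b c).pd_eq]
  rfl

theorem gam_apply (m r s : ℝ) :
    gam m r s 0 0 0 = -m / r ^ 2 ∧ gam m r s 0 2 2 = 2 * r / s ^ 3 ∧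
    gam m r s 0 3 3 = 2 * r / s ^ 3 ∧
    gam m r s 1 0 0 = -(3 * m * s / r ^ 2 + 2 * m ^ 2 / r ^ 3) ∧ gam m r s 1 0 1 = m / r ^ 2 ∧
    gam m r s 1 1 0 = m / r ^ 2 ∧ gam m r s 1 0 2 = -3 ∧ gam m r s 1 2 0 = -3 ∧
    gam m r s 1 2 2 = 6 * r / s ^ 2 + 4 * m / s ^ 3 ∧
    gam m r s 1 3 3 = 6 * r / s ^ 2 + 4 * m / s ^ 3 ∧
    gam m r s 2 0 0 = -3 * s ^ 3 / (2 * r ^ 2) ∧ gam m r s 2 1 2 = 1 / r ∧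
    gam m r s 2 2 1 = 1 / r ∧ gam m r s 2 2 2 = -3 / s ∧ gam m r s 2 3 3 = 3 / s ∧
    gam m r s 3 1 3 = 1 / r ∧ gam m r s 3 3 1 = 1 / r ∧ gam m r s 3 2 3 = -3 / s ∧
    gam m r s 3 3 2 = -3 / s ∧ (∀ c, gam m r s 0 1 c = 0) ∧ (∀ b, gam m r s 0 b 1 = 0) ∧
    gam m r s 0 0 2 = 0 ∧ gam m r s 0 0 3 = 0 ∧ gam m r s 0 2 0 = 0 ∧ gam m r s 0 2 3 = 0 ∧
    gam m r s 0 3 0 = 0 ∧ gam m r s 0 3 2 = 0 ∧ gam m r s 1 0 3 = 0 ∧ gam m r s 1 1 1 = 0 ∧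
    gam m r s 1 1 2 = 0 ∧ gam m r s 1 1 3 = 0 ∧ gam m r s 1 2 1 = 0 ∧ gam m r s 1 2 3 = 0 ∧
    gam m r s 1 3 0 = 0 ∧ gam m r s 1 3 1 = 0 ∧ gam m r s 1 3 2 = 0 ∧ gam m r s 2 0 1 = 0 ∧
    gam m r s 2 0 2 = 0 ∧ gam m r s 2 0 3 = 0 ∧ gam m r s 2 1 0 = 0 ∧ gam m r s 2 1 1 = 0 ∧
    gam m r s 2 1 3 = 0 ∧ gam m r s 2 2 0 = 0 ∧ gam m r s 2 2 3 = 0 ∧ gam m r s 2 3 0 = 0 ∧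
    gam m r s 2 3 1 = 0 ∧ gam m r s 2 3 2 = 0 ∧ (∀ c, gam m r s 3 0 c = 0) ∧
    (∀ b, gam m r s 3 b 0 = 0) ∧ gam m r s 3 1 1 = 0 ∧ gam m r s 3 1 2 = 0 ∧
    gam m r s 3 2 1 = 0 ∧ gam m r s 3 2 2 = 0 ∧ gam m r s 3 3 3 = 0 := by
  and_intros <;> first
    | rfl
    | (intro c; fin_cases c <;> rfl)

theorem dgamR_apply (m r s : ℝ) :
    dgamR m r s 0 0 0 = 2 * m / r ^ 3 ∧ dgamR m r s 0 2 2 = 2 / s ^ 3 ∧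
    dgamR m r s 0 3 3 = 2 / s ^ 3 ∧ dgamR m r s 1 0 0 = 6 * m * s / r ^ 3 + 6 * m ^ 2 / r ^ 4 ∧
    dgamR m r s 1 0 1 = -2 * m / r ^ 3 ∧ dgamR m r s 1 1 0 = -2 * m / r ^ 3 ∧
    dgamR m r s 1 2 2 = 6 / s ^ 2 ∧ dgamR m r s 1 3 3 = 6 / s ^ 2 ∧
    dgamR m r s 2 0 0 = 3 * s ^ 3 / r ^ 3 ∧ dgamR m r s 2 1 2 = -1 / r ^ 2 ∧
    dgamR m r s 2 2 1 = -1 / r ^ 2 ∧ dgamR m r s 3 1 3 = -1 / r ^ 2 ∧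
    dgamR m r s 3 3 1 = -1 / r ^ 2 ∧ (∀ c, dgamR m r s 0 1 c = 0) ∧
    (∀ b, dgamR m r s 0 b 1 = 0) ∧ dgamR m r s 0 0 2 = 0 ∧ dgamR m r s 0 0 3 = 0 ∧
    dgamR m r s 0 2 0 = 0 ∧ dgamR m r s 0 2 3 = 0 ∧ dgamR m r s 0 3 0 = 0 ∧
    dgamR m r s 0 3 2 = 0 ∧ dgamR m r s 1 0 2 = 0 ∧ dgamR m r s 1 0 3 = 0 ∧
    dgamR m r s 1 1 1 = 0 ∧ dgamR m r s 1 1 2 = 0 ∧ dgamR m r s 1 1 3 = 0 ∧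
    dgamR m r s 1 2 0 = 0 ∧ dgamR m r s 1 2 1 = 0 ∧ dgamR m r s 1 2 3 = 0 ∧
    dgamR m r s 1 3 0 = 0 ∧ dgamR m r s 1 3 1 = 0 ∧ dgamR m r s 1 3 2 = 0 ∧
    (∀ c, dgamR m r s 2 3 c = 0) ∧ (∀ b, dgamR m r s 2 b 3 = 0) ∧ dgamR m r s 2 0 1 = 0 ∧
    dgamR m r s 2 0 2 = 0 ∧ dgamR m r s 2 1 0 = 0 ∧ dgamR m r s 2 1 1 = 0 ∧
    dgamR m r s 2 2 0 = 0 ∧ dgamR m r s 2 2 2 = 0 ∧ (∀ c, dgamR m r s 3 0 c = 0) ∧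
    (∀ c, dgamR m r s 3 2 c = 0) ∧ (∀ b, dgamR m r s 3 b 0 = 0) ∧
    (∀ b, dgamR m r s 3 b 2 = 0) ∧ dgamR m r s 3 1 1 = 0 ∧ dgamR m r s 3 3 3 = 0 := by
  and_intros <;> first
    | rfl
    | (intro c; fin_cases c <;> rfl)

theorem dgamX_apply (m r s : ℝ) :
    dgamX m r s 0 2 2 = -12 * r / s ^ 4 ∧ dgamX m r s 0 3 3 = -12 * r / s ^ 4 ∧
    dgamX m r s 1 0 0 = -6 * m / r ^ 2 ∧ dgamX m r s 1 2 2 = -24 * r / s ^ 3 - 24 * m / s ^ 4 ∧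
    dgamX m r s 1 3 3 = -24 * r / s ^ 3 - 24 * m / s ^ 4 ∧
    dgamX m r s 2 0 0 = -9 * s ^ 2 / r ^ 2 ∧ dgamX m r s 2 2 2 = 6 / s ^ 2 ∧
    dgamX m r s 2 3 3 = -6 / s ^ 2 ∧ dgamX m r s 3 2 3 = 6 / s ^ 2 ∧
    dgamX m r s 3 3 2 = 6 / s ^ 2 ∧ (∀ c, dgamX m r s 0 0 c = 0) ∧
    (∀ c, dgamX m r s 0 1 c = 0) ∧ (∀ b, dgamX m r s 0 b 0 = 0) ∧
    (∀ b, dgamX m r s 0 b 1 = 0) ∧ dgamX m r s 0 2 3 = 0 ∧ dgamX m r s 0 3 2 = 0 ∧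
    (∀ c, dgamX m r s 1 1 c = 0) ∧ (∀ b, dgamX m r s 1 b 1 = 0) ∧ dgamX m r s 1 0 2 = 0 ∧
    dgamX m r s 1 0 3 = 0 ∧ dgamX m r s 1 2 0 = 0 ∧ dgamX m r s 1 2 3 = 0 ∧
    dgamX m r s 1 3 0 = 0 ∧ dgamX m r s 1 3 2 = 0 ∧ (∀ c, dgamX m r s 2 1 c = 0) ∧
    (∀ b, dgamX m r s 2 b 1 = 0) ∧ dgamX m r s 2 0 2 = 0 ∧ dgamX m r s 2 0 3 = 0 ∧
    dgamX m r s 2 2 0 = 0 ∧ dgamX m r s 2 2 3 = 0 ∧ dgamX m r s 2 3 0 = 0 ∧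
    dgamX m r s 2 3 2 = 0 ∧ (∀ c, dgamX m r s 3 0 c = 0) ∧ (∀ c, dgamX m r s 3 1 c = 0) ∧
    (∀ b, dgamX m r s 3 b 0 = 0) ∧ (∀ b, dgamX m r s 3 b 1 = 0) ∧ dgamX m r s 3 2 2 = 0 ∧
    dgamX m r s 3 3 3 = 0 := by
  and_intros <;> first
    | rfl
    | (intro c; fin_cases c <;> rfl)

theorem dgam_apply (m r s : ℝ) (a b c : Fin 4) :
    dgam m r s 0 a b c = 0 ∧ dgam m r s 1 a b c = dgamR m r s a b c ∧
    dgam m r s 2 a b c = dgamX m r s a b c ∧ dgam m r s 3 a b c = 0 :=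
  ⟨rfl, rfl, rfl, rfl⟩

/-! ### Curvature -/

theorem riemannUp_g2 (m : ℝ) {p : Pt} (hp : p ∈ domain) (a b c d : Fin 4) :
    riemannUp (g2 m) a b c d p =
      dgam m (p 1) (zz p) a d b c - dgam m (p 1) (zz p) b d a c
      + ∑ e, (gam m (p 1) (zz p) d a e * gam m (p 1) (zz p) e b c
        - gam m (p 1) (zz p) d b e * gam m (p 1) (zz p) e a c) := by
  simp only [riemannUp, christoffel_g2 m hp, pd_christoffel_g2 m hp]

theorem ricci_g2 (m : ℝ) {p : Pt} (hp : p ∈ domain) (a b : Fin 4) : ricci (g2 m) a b p = 0 := by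
  have hr := (r_pos hp).ne'
  have hs := (zz_pos hp).ne'
  simp only [ricci, riemannUp_g2 m hp, Fin.sum_univ_four]
  generalize zz p = s at *
  generalize p 1 = r at *
  fin_cases a <;> fin_cases b <;>
    simp only [gam_apply, dgam_apply, dgamR_apply, dgamX_apply, Fin.zero_eta, Fin.mk_one,
      Fin.reduceFinMk, mul_zero, zero_mul, add_zero, zero_add, sub_zero, zero_sub, sub_self] <;>
    field_simp <;> ring

theorem riemann_swap (g : Metric) (a b c d : Fin 4) (p : Pt) :
    riemann g a b c d p = -riemann g b a c d p := by
  simp only [riemann, riemannUp, ← Finset.sum_neg_distrib]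
  refine Finset.sum_congr rfl fun e _ => ?_
  rw [← neg_mul]
  congr 1
  rw [neg_add, ← Finset.sum_neg_distrib]
  simp only [neg_sub]

theorem riemann_self (g : Metric) (a c d : Fin 4) (p : Pt) : riemann g a a c d p = 0 := by
  have := riemann_swap g a a c d p
  linarith

theorem g2_apply (m : ℝ) (p : Pt) :
    g2 m p 0 0 = -(3 * zz p + 2 * m / p 1) ∧ g2 m p 0 1 = 1 ∧ g2 m p 1 0 = 1 ∧
    g2 m p 2 2 = -2 * p 1 ^ 2 * (zz p ^ 3)⁻¹ ∧ g2 m p 3 3 = -2 * p 1 ^ 2 * (zz p ^ 3)⁻¹ ∧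
    g2 m p 0 2 = 0 ∧ g2 m p 0 3 = 0 ∧ g2 m p 1 1 = 0 ∧ g2 m p 1 2 = 0 ∧ g2 m p 1 3 = 0 ∧
    g2 m p 2 0 = 0 ∧ g2 m p 2 1 = 0 ∧ g2 m p 2 3 = 0 ∧ g2 m p 3 0 = 0 ∧ g2 m p 3 1 = 0 ∧
    g2 m p 3 2 = 0 := by
  and_intros <;> rfl

/-- `R_{urcd}`. -/
def rieUR (m r : ℝ) : Fin 4 → Fin 4 → ℝ
  | 0, 1 => -2 * m / r ^ 3
  | 1, 0 => 2 * m / r ^ 3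
  | 0, 2 => 3 / r
  | 2, 0 => -3 / r
  | _, _ => 0

/-- `R_{uxcd}`. -/
def rieUX (m r s : ℝ) : Fin 4 → Fin 4 → ℝ
  | 0, 1 => 3 / r
  | 1, 0 => -3 / r
  | 0, 2 => -9 / s - 6 * m / (r * s ^ 2) - 4 * m ^ 2 / (r ^ 2 * s ^ 3)
  | 2, 0 => 9 / s + 6 * m / (r * s ^ 2) + 4 * m ^ 2 / (r ^ 2 * s ^ 3)
  | 1, 2 => 2 * m / (r * s ^ 3)
  | 2, 1 => -2 * m / (r * s ^ 3)
  | _, _ => 0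

/-- `R_{uycd}`. -/
def rieUY (m r s : ℝ) : Fin 4 → Fin 4 → ℝ
  | 0, 3 => 9 / s - 6 * m / (r * s ^ 2) - 4 * m ^ 2 / (r ^ 2 * s ^ 3)
  | 3, 0 => -9 / s + 6 * m / (r * s ^ 2) + 4 * m ^ 2 / (r ^ 2 * s ^ 3)
  | 1, 3 => 2 * m / (r * s ^ 3)
  | 3, 1 => -2 * m / (r * s ^ 3)
  | 2, 3 => -6 * r / s ^ 3
  | 3, 2 => 6 * r / s ^ 3
  | _, _ => 0

/-- `R_{rxcd}`. -/
def rieRX (m r s : ℝ) : Fin 4 → Fin 4 → ℝ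
  | 0, 2 => 2 * m / (r * s ^ 3)
  | 2, 0 => -2 * m / (r * s ^ 3)
  | _, _ => 0

/-- `R_{rycd}`. -/
def rieRY (m r s : ℝ) : Fin 4 → Fin 4 → ℝ
  | 0, 3 => 2 * m / (r * s ^ 3)
  | 3, 0 => -2 * m / (r * s ^ 3)
  | _, _ => 0

theorem riemann_g2 (m : ℝ) {p : Pt} (hp : p ∈ domain) (a b c d : Fin 4) :
    riemann (g2 m) a b c d p =
      ∑ e, (dgam m (p 1) (zz p) a e b c - dgam m (p 1) (zz p) b e a c
        + ∑ f, (gam m (p 1) (zz p) e a f * gam m (p 1) (zz p) f b c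
          - gam m (p 1) (zz p) e b f * gam m (p 1) (zz p) f a c)) * g2 m p e d := by
  simp only [riemann, riemannUp_g2 m hp]

theorem riemann_g2_ur (m : ℝ) {p : Pt} (hp : p ∈ domain) (c d : Fin 4) :
    riemann (g2 m) 0 1 c d p = rieUR m (p 1) c d := by
  have hr := (r_pos hp).ne'
  have hs := (zz_pos hp).ne'
  simp only [riemann_g2 m hp, Fin.sum_univ_four]
  fin_cases c <;> fin_cases d <;>
    simp only [gam_apply, dgam_apply, dgamR_apply, g2_apply, rieUR, Fin.zero_eta,
      Fin.mk_one, Fin.reduceFinMk, mul_zero, zero_mul, add_zero, zero_add, sub_zero, zero_sub,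
      sub_self] <;>
    field_simp <;> ring

theorem riemann_g2_ux (m : ℝ) {p : Pt} (hp : p ∈ domain) (c d : Fin 4) :
    riemann (g2 m) 0 2 c d p = rieUX m (p 1) (zz p) c d := by
  have hr := (r_pos hp).ne'
  have hs := (zz_pos hp).ne'
  simp only [riemann_g2 m hp, Fin.sum_univ_four]
  fin_cases c <;> fin_cases d <;>
    simp only [gam_apply, dgam_apply, dgamX_apply, g2_apply, rieUX, Fin.zero_eta,
      Fin.mk_one, Fin.reduceFinMk, mul_zero, zero_mul, add_zero, zero_add, sub_zero, zero_sub,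
      sub_self] <;>
    field_simp <;> ring

theorem riemann_g2_uy (m : ℝ) {p : Pt} (hp : p ∈ domain) (c d : Fin 4) :
    riemann (g2 m) 0 3 c d p = rieUY m (p 1) (zz p) c d := by
  have hr := (r_pos hp).ne'
  have hs := (zz_pos hp).ne'
  simp only [riemann_g2 m hp, Fin.sum_univ_four]
  fin_cases c <;> fin_cases d <;>
    simp only [gam_apply, dgam_apply, g2_apply, rieUY, Fin.zero_eta,
      Fin.mk_one, Fin.reduceFinMk, mul_zero, zero_mul, add_zero, zero_add, sub_zero, zero_sub,
      sub_self] <;>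
    field_simp <;> ring

theorem riemann_g2_rx (m : ℝ) {p : Pt} (hp : p ∈ domain) (c d : Fin 4) :
    riemann (g2 m) 1 2 c d p = rieRX m (p 1) (zz p) c d := by
  have hr := (r_pos hp).ne'
  have hs := (zz_pos hp).ne'
  simp only [riemann_g2 m hp, Fin.sum_univ_four]
  fin_cases c <;> fin_cases d <;>
    simp only [gam_apply, dgam_apply, dgamR_apply, dgamX_apply, g2_apply, rieRX, Fin.zero_eta,
      Fin.mk_one, Fin.reduceFinMk, mul_zero, zero_mul, add_zero, zero_add, sub_zero, zero_sub,
      sub_self] <;>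
    field_simp <;> ring

theorem riemann_g2_ry (m : ℝ) {p : Pt} (hp : p ∈ domain) (c d : Fin 4) :
    riemann (g2 m) 1 3 c d p = rieRY m (p 1) (zz p) c d := by
  have hr := (r_pos hp).ne'
  have hs := (zz_pos hp).ne'
  simp only [riemann_g2 m hp, Fin.sum_univ_four]
  fin_cases c <;> fin_cases d <;>
    simp only [gam_apply, dgam_apply, dgamR_apply, g2_apply, rieRY, Fin.zero_eta,
      Fin.mk_one, Fin.reduceFinMk, mul_zero, zero_mul, add_zero, zero_add, sub_zero, zero_sub,
      sub_self] <;>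
    field_simp <;> ring

theorem weyl_g2 (m : ℝ) {p : Pt} (hp : p ∈ domain) (a b c d : Fin 4) :
    weyl (g2 m) a b c d p = riemann (g2 m) a b c d p := by
  simp [weyl, scalarCurv, ricci_g2 m hp]

/-! ### The null tetrad and the Weyl scalars -/

theorem t2_l_apply (m : ℝ) (p : Pt) :
    (t2 m).l p 0 = 0 ∧ (t2 m).l p 1 = 1 ∧ (t2 m).l p 2 = 0 ∧ (t2 m).l p 3 = 0 :=
  ⟨rfl, rfl, rfl, rfl⟩

theorem t2_n_apply (m : ℝ) (p : Pt) :
    (t2 m).n p 0 = 1 ∧ (t2 m).n p 1 = -(H2 m p : ℂ) ∧ (t2 m).n p 2 = 0 ∧ (t2 m).n p 3 = 0 := by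
  simp [t2, rtTetrad, dU, dR]

theorem t2_m_apply (m : ℝ) (p : Pt) :
    (t2 m).m p 0 = 0 ∧ (t2 m).m p 1 = 0 ∧ (t2 m).m p 2 = ((P2 p / p 1 : ℝ) : ℂ) * (1 / 2) ∧
    (t2 m).m p 3 = ((P2 p / p 1 : ℝ) : ℂ) * (-Complex.I / 2) := by
  simp [t2, rtTetrad, dZ]

theorem t2_mb_apply (m : ℝ) (p : Pt) :
    (t2 m).mb p 0 = 0 ∧ (t2 m).mb p 1 = 0 ∧ (t2 m).mb p 2 = ((P2 p / p 1 : ℝ) : ℂ) * (1 / 2) ∧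
    (t2 m).mb p 3 = ((P2 p / p 1 : ℝ) : ℂ) * (Complex.I / 2) := by
  simp [t2, rtTetrad, dZb]

/-- `g(∂_ζ, ∂_ζ̄) (P/r)² = −1`, in the chart. -/
theorem gxx_mul (m : ℝ) {p : Pt} (hp : p ∈ domain) :
    ((g2 m p 2 2 : ℝ) : ℂ) * ((P2 p / p 1 : ℝ) : ℂ) ^ 2 = -2 := by
  have hr := (r_pos hp).ne'
  have hs := (zz_pos hp).ne'
  have h : g2 m p 2 2 * (P2 p / p 1) ^ 2 = -2 := by
    simp only [g2_apply, div_pow, P2_sq hp]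
    field_simp
  exact_mod_cast h

theorem ip_g2 (m : ℝ) (p : Pt) (v w : CVec) :
    ip (g2 m) p v w = -((3 * zz p + 2 * m / p 1 : ℝ) : ℂ) * v 0 * w 0 + v 0 * w 1 + v 1 * w 0
      + ((g2 m p 2 2 : ℝ) : ℂ) * (v 2 * w 2 + v 3 * w 3) := by
  simp only [ip, Fin.sum_univ_four, g2_apply]
  push_cast
  ring

theorem isNullAt_t2 (m : ℝ) {p : Pt} (hp : p ∈ domain) : (t2 m).IsNullAt (g2 m) p := by
  have hg := gxx_mul m hp
  refine ⟨fun a => ?_, fun a => ?_, fun a => ?_, ?_⟩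
  · fin_cases a <;> simp [t2, rtTetrad, dR]
  · fin_cases a <;> simp [t2, rtTetrad, dR, dU]
  · fin_cases a <;> simp [t2, rtTetrad, dZ, dZb, Complex.conj_ofNat]
  have hI := Complex.I_sq
  simp only [ip_g2, t2_l_apply, t2_n_apply, t2_m_apply, t2_mb_apply]
  generalize ((g2 m p 2 2 : ℝ) : ℂ) = G at *
  generalize ((P2 p / p 1 : ℝ) : ℂ) = c at *
  refine ⟨by ring, ?_, by ring, ?_, ?_, ?_, by ring, by ring, by ring, by ring⟩
  · linear_combination (1 / 2) * hg - G * c ^ 2 / 4 * hI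
  · simp only [H2]
    push_cast
    ring
  · linear_combination G * c ^ 2 / 4 * hI
  · linear_combination G * c ^ 2 / 4 * hI

theorem g2_eq_rtMetric (m : ℝ) {p : Pt} (hp : p ∈ domain) : g2 m p = rtMetric P2 (H2 m) p := by
  unfold g2 rtMetric
  rw [P2_sq hp]
  have : 2 * H2 m p = -(3 * zz p + 2 * m / p 1) := by
    unfold H2; ring
  rw [this]

theorem weylC_g2 (m : ℝ) {p : Pt} (hp : p ∈ domain) (v₁ v₂ v₃ v₄ : CVec) :
    weylC (g2 m) p v₁ v₂ v₃ v₄ =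
      ∑ a, ∑ b, ∑ c, ∑ d, (riemann (g2 m) a b c d p : ℂ) * v₁ a * v₂ b * v₃ c * v₄ d := by
  simp only [weylC, weyl_g2 m hp]

theorem psi0_g2 (m : ℝ) {p : Pt} (hp : p ∈ domain) : Psi (g2 m) (t2 m) 0 p = 0 := by
  change weylC _ p _ _ _ _ = 0
  simp only [weylC_g2 m hp, Fin.sum_univ_four, t2_l_apply, t2_m_apply, mul_zero, zero_mul,
    add_zero, zero_add, mul_one, riemann_g2_rx m hp, riemann_g2_ry m hp, rieRX, rieRY,
    Complex.ofReal_zero]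

theorem psi1_g2 (m : ℝ) {p : Pt} (hp : p ∈ domain) : Psi (g2 m) (t2 m) 1 p = 0 := by
  change weylC _ p _ _ _ _ = 0
  simp only [weylC_g2 m hp, Fin.sum_univ_four, t2_l_apply, t2_m_apply, t2_n_apply, mul_zero,
    zero_mul, add_zero, zero_add, mul_one, riemann_g2_rx m hp, riemann_g2_ry m hp, rieRX, rieRY,
    Complex.ofReal_zero]

theorem psi2_g2 (m : ℝ) {p : Pt} (hp : p ∈ domain) :
    Psi (g2 m) (t2 m) 2 p = ((-m / p 1 ^ 3 : ℝ) : ℂ) := by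
  have hr := (r_pos hp).ne'
  have hs := (zz_pos hp).ne'
  have hP := P2_sq hp
  change weylC _ p _ _ _ _ = _
  simp only [weylC_g2 m hp, Fin.sum_univ_four, t2_l_apply, t2_m_apply, t2_mb_apply, t2_n_apply,
    mul_zero, zero_mul, add_zero, zero_add, mul_one, riemann_g2_rx m hp, riemann_g2_ry m hp, rieRX,
    rieRY, Complex.ofReal_zero]
  have h : -m / p 1 ^ 3 = (-2 * m / (p 1 * zz p ^ 3)) * (P2 p / p 1) ^ 2 / 2 := by
    rw [div_pow, hP]
    field_simp
  rw [h]
  push_cast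
  linear_combination (-(-2 * m / (p 1 * zz p ^ 3)) * (P2 p / p 1) ^ 2 / 4 : ℂ) * Complex.I_sq

theorem psi3_g2 (m : ℝ) {p : Pt} (hp : p ∈ domain) :
    Psi (g2 m) (t2 m) 3 p = ((3 / 2 * zz p ^ (3 / 2 : ℝ) / p 1 ^ 2 : ℝ) : ℂ) := by
  have hr := (r_pos hp).ne'
  change weylC _ p _ _ _ _ = ((3 / 2 * P2 p / p 1 ^ 2 : ℝ) : ℂ)
  simp only [weylC_g2 m hp, Fin.sum_univ_four, t2_l_apply, t2_mb_apply, t2_n_apply,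
    mul_zero, zero_mul, add_zero, zero_add, mul_one, riemann_swap _ 1 0, riemann_self,
    riemann_g2_ur m hp, rieUR, Complex.ofReal_zero, Complex.ofReal_neg, neg_zero]
  have h : 3 / 2 * P2 p / p 1 ^ 2 = 3 / p 1 * (P2 p / p 1) / 2 := by
    field_simp
  rw [h]
  push_cast
  ring

theorem psi4_g2 (m : ℝ) {p : Pt} (hp : p ∈ domain) :
    Psi (g2 m) (t2 m) 4 p = ((-(9 / 2) * zz p ^ 2 / p 1 ^ 2 : ℝ) : ℂ) := by
  have hr := (r_pos hp).ne'
  have hs := (zz_pos hp).ne'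
  have hP := P2_sq hp
  change weylC _ p _ _ _ _ = _
  simp only [weylC_g2 m hp, Fin.sum_univ_four, t2_mb_apply, t2_n_apply,
    mul_zero, zero_mul, add_zero, zero_add, mul_one, riemann_swap _ 2 0, riemann_swap _ 2 1,
    riemann_swap _ 3 0, riemann_swap _ 3 1,
    riemann_g2_ux m hp, riemann_g2_uy m hp, riemann_g2_rx m hp, riemann_g2_ry m hp,
    rieUX, rieUY, rieRX, rieRY, Complex.ofReal_zero, Complex.ofReal_neg, neg_zero]
  have h : -(9 / 2) * zz p ^ 2 / p 1 ^ 2 = -(9 / 2) / zz p * (P2 p / p 1) ^ 2 := by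
    rw [div_pow, hP]
    field_simp
  rw [h]
  have hr' : (p 1 : ℂ) ≠ 0 := by exact_mod_cast hr
  have hs' : (zz p : ℂ) ≠ 0 := by exact_mod_cast hs
  simp only [H2]
  push_cast
  linear_combination (norm := skip) (9 / zz p * (P2 p / p 1) ^ 2 / 4 : ℂ) * Complex.I_sq
  field_simp
  ring

/-! ### Covariant derivatives of the tetrad -/

theorem hasGrad_H2 (m : ℝ) {p : Pt} (hp : p ∈ domain) :
    HasGrad (H2 m) (m / p 1 ^ 2) (-3) p := by
  refine ((HasGrad.const (1 / 2) p).mul (hasGrad_guu m hp)).congr (fun q => ?_) ?_ ?_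
  · simp only [H2]; ring
  · ring
  · ring

theorem hasGrad_P2_mul_zpow (k : ℤ) {p : Pt} (hp : p ∈ domain) :
    HasGrad (fun q => P2 q * q 1 ^ k) (P2 p * (k * p 1 ^ (k - 1)))
      (3 * P2 p / zz p * p 1 ^ k) p :=
  ((hasGrad_P2 hp).mul (HasGrad.of_r (hasDerivAt_zpow k (p 1) (Or.inl (r_pos hp).ne')))).congr
    (fun _ => rfl) (by ring) (by ring)

theorem hasGrad_P2_div {p : Pt} (hp : p ∈ domain) :
    HasGrad (fun q => P2 q / q 1) (-P2 p / p 1 ^ 2) (3 * P2 p / (zz p * p 1)) p := by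
  refine (hasGrad_P2_mul_zpow (-1) hp).congr (fun q => ?_) ?_ ?_ <;>
    norm_num [zpow_neg, zpow_ofNat] <;> ring

theorem pd_const {E : Type*} [NormedAddCommGroup E] [NormedSpace ℝ E] (i : Fin 4) (c : E) (p : Pt) :
    pd i (fun _ => c) p = 0 := by
  simp [pd]

theorem pd_t2_l (m : ℝ) (p : Pt) (i a : Fin 4) : pd i (fun q => (t2 m).l q a) p = 0 :=
  pd_const i (dR a) p

theorem pd_t2_n (m : ℝ) {p : Pt} (hp : p ∈ domain) (i a : Fin 4) :
    pd i (fun q => (t2 m).n q a) p = ((![0, m / p 1 ^ 2, -3, 0] i : ℝ) : ℂ) * -dR a := by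
  rw [← (hasGrad_H2 m hp).pd_ofReal_mul (-dR a) i]
  have h : (fun q => (t2 m).n q a) = fun q => dU a + (H2 m q : ℂ) * -dR a := by
    funext q
    simp only [t2, rtTetrad, Pi.sub_apply, Pi.smul_apply, smul_eq_mul]
    ring
  rw [h]
  simp only [pd, fderiv_const_add]

theorem pd_t2_m (m : ℝ) {p : Pt} (hp : p ∈ domain) (i a : Fin 4) :
    pd i (fun q => (t2 m).m q a) p =
      ((![0, -P2 p / p 1 ^ 2, 3 * P2 p / (zz p * p 1), 0] i : ℝ) : ℂ) * dZ a :=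
  (hasGrad_P2_div hp).pd_ofReal_mul (dZ a) i

theorem pd_t2_mb (m : ℝ) {p : Pt} (hp : p ∈ domain) (i a : Fin 4) :
    pd i (fun q => (t2 m).mb q a) p =
      ((![0, -P2 p / p 1 ^ 2, 3 * P2 p / (zz p * p 1), 0] i : ℝ) : ℂ) * dZb a :=
  (hasGrad_P2_div hp).pd_ofReal_mul (dZb a) i

theorem dirD_t2_l (m : ℝ) (f : Pt → ℂ) (p : Pt) : dirD (t2 m).l f p = pd 1 f p := by
  simp only [dirD, Fin.sum_univ_four, t2_l_apply]
  ring

theorem dirD_t2_n (m : ℝ) (f : Pt → ℂ) (p : Pt) :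
    dirD (t2 m).n f p = pd 0 f p - (H2 m p : ℂ) * pd 1 f p := by
  simp only [dirD, Fin.sum_univ_four, t2_n_apply]
  ring

theorem dirD_t2_m (m : ℝ) (f : Pt → ℂ) (p : Pt) :
    dirD (t2 m).m f p = ((P2 p / p 1 : ℝ) : ℂ) / 2 * (pd 2 f p - Complex.I * pd 3 f p) := by
  simp only [dirD, Fin.sum_univ_four, t2_m_apply]
  ring

theorem dirD_t2_mb (m : ℝ) (f : Pt → ℂ) (p : Pt) :
    dirD (t2 m).mb f p = ((P2 p / p 1 : ℝ) : ℂ) / 2 * (pd 2 f p + Complex.I * pd 3 f p) := by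
  simp only [dirD, Fin.sum_univ_four, t2_mb_apply]
  ring

theorem dR_apply : dR 0 = 0 ∧ dR 1 = 1 ∧ dR 2 = 0 ∧ dR 3 = 0 := ⟨rfl, rfl, rfl, rfl⟩

theorem dZ_apply : dZ 0 = 0 ∧ dZ 1 = 0 ∧ dZ 2 = 1 / 2 ∧ dZ 3 = -Complex.I / 2 :=
  ⟨rfl, rfl, rfl, rfl⟩

theorem dZb_apply : dZb 0 = 0 ∧ dZb 1 = 0 ∧ dZb 2 = 1 / 2 ∧ dZb 3 = Complex.I / 2 :=
  ⟨rfl, rfl, rfl, rfl⟩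

theorem vec4_apply {α : Type*} (a b c d : α) :
    ![a, b, c, d] 0 = a ∧ ![a, b, c, d] 1 = b ∧ ![a, b, c, d] 2 = c ∧ ![a, b, c, d] 3 = d :=
  ⟨rfl, rfl, rfl, rfl⟩

/-- The contraction `Γ^a_{bc} v^b w^c`. -/
theorem sum_christoffel_g2 (m : ℝ) {p : Pt} (hp : p ∈ domain) (a : Fin 4) (v w : CVec) :
    ∑ b, ∑ c, (christoffel (g2 m) a b c p : ℂ) * v b * w c =
      ![-(m / p 1 ^ 2 : ℂ) * v 0 * w 0 + 2 * p 1 / zz p ^ 3 * (v 2 * w 2 + v 3 * w 3),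
        2 * H2 m p * (m / p 1 ^ 2 * v 0 * w 0) + m / p 1 ^ 2 * (v 0 * w 1 + v 1 * w 0)
          - 3 * (v 0 * w 2 + v 2 * w 0) - 2 * H2 m p * (2 * p 1 / zz p ^ 3)
            * (v 2 * w 2 + v 3 * w 3),
        -3 * zz p ^ 3 / (2 * p 1 ^ 2) * v 0 * w 0 + (v 1 * w 2 + v 2 * w 1) / p 1
          - 3 / zz p * (v 2 * w 2 - v 3 * w 3),
        (v 1 * w 3 + v 3 * w 1) / p 1 - 3 / zz p * (v 2 * w 3 + v 3 * w 2)] a := by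
  have hr : (p 1 : ℂ) ≠ 0 := by exact_mod_cast (r_pos hp).ne'
  have hs : (zz p : ℂ) ≠ 0 := by exact_mod_cast (zz_pos hp).ne'
  simp only [christoffel_g2 m hp, Fin.sum_univ_four]
  fin_cases a <;>
    simp only [gam_apply, H2, Fin.zero_eta, Fin.mk_one, Fin.reduceFinMk, vec4_apply] <;>
    push_cast <;> field_simp <;> ring

/-- The tetrad functions are rational in `r` and `√(ζ + ζ̄)`. -/
theorem exists_sqrt_zz {p : Pt} (hp : p ∈ domain) :
    ∃ q : ℝ, 0 < q ∧ zz p = q ^ 2 ∧ P2 p = q ^ 3 := by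
  have hs := zz_pos hp
  refine ⟨√(zz p), Real.sqrt_pos.2 hs, (Real.sq_sqrt hs.le).symm, ?_⟩
  rw [P2, Real.sqrt_eq_rpow, ← Real.rpow_natCast, ← Real.rpow_mul hs.le]
  norm_num

theorem covD_l_l (m : ℝ) {p : Pt} (hp : p ∈ domain) : covD (g2 m) (t2 m).l (t2 m).l p = 0 := by
  funext a
  simp only [covD, sum_christoffel_g2 m hp, dirD_t2_l, pd_t2_l, t2_l_apply]
  fin_cases a <;> simp

theorem covD_l_n (m : ℝ) {p : Pt} (hp : p ∈ domain) : covD (g2 m) (t2 m).l (t2 m).n p = 0 := by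
  funext a
  simp only [covD, sum_christoffel_g2 m hp, dirD_t2_l, pd_t2_n m hp, t2_l_apply, t2_n_apply]
  fin_cases a <;> simp [dR]

theorem covD_l_m (m : ℝ) {p : Pt} (hp : p ∈ domain) : covD (g2 m) (t2 m).l (t2 m).m p = 0 := by
  have hr : (p 1 : ℂ) ≠ 0 := by exact_mod_cast (r_pos hp).ne'
  funext a
  simp only [covD, sum_christoffel_g2 m hp, dirD_t2_l, pd_t2_m m hp, t2_l_apply, t2_m_apply]
  fin_cases a <;> simp [dZ] <;> field_simp <;> ring

theorem covD_l_mb (m : ℝ) {p : Pt} (hp : p ∈ domain) : covD (g2 m) (t2 m).l (t2 m).mb p = 0 := by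
  have hr : (p 1 : ℂ) ≠ 0 := by exact_mod_cast (r_pos hp).ne'
  funext a
  simp only [covD, sum_christoffel_g2 m hp, dirD_t2_l, pd_t2_mb m hp, t2_l_apply, t2_mb_apply]
  fin_cases a <;> simp [dZb] <;> field_simp <;> ring

theorem covD_n_l (m : ℝ) {p : Pt} (hp : p ∈ domain) :
    covD (g2 m) (t2 m).n (t2 m).l p = (m / p 1 ^ 2 : ℂ) • (t2 m).l p := by
  funext a
  simp only [covD, sum_christoffel_g2 m hp, dirD_t2_n, pd_t2_l, t2_l_apply, t2_n_apply,
    Pi.smul_apply, smul_eq_mul]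
  fin_cases a <;> simp [t2_l_apply]

theorem covD_n_n (m : ℝ) {p : Pt} (hp : p ∈ domain) :
    covD (g2 m) (t2 m).n (t2 m).n p = -(m / p 1 ^ 2 : ℂ) • (t2 m).n p
      - (3 * P2 p / (2 * p 1) : ℂ) • ((t2 m).m p + (t2 m).mb p) := by
  obtain ⟨q, hq0, hq, hP⟩ := exists_sqrt_zz hp
  have hr : (p 1 : ℂ) ≠ 0 := by exact_mod_cast (r_pos hp).ne'
  have hq' : (q : ℂ) ≠ 0 := by exact_mod_cast hq0.ne'
  funext a
  simp only [covD, sum_christoffel_g2 m hp, dirD_t2_n, pd_t2_n m hp,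
    Pi.add_apply, Pi.sub_apply, Pi.smul_apply, smul_eq_mul]
  fin_cases a <;>
    simp only [t2_n_apply, t2_m_apply, t2_mb_apply, dR_apply, Fin.zero_eta, Fin.mk_one,
      Fin.reduceFinMk, vec4_apply, hq, hP] <;>
    push_cast
  all_goals
    field_simp
    try ring

theorem covD_n_m (m : ℝ) {p : Pt} (hp : p ∈ domain) :
    covD (g2 m) (t2 m).n (t2 m).m p = -(3 * P2 p / (2 * p 1) : ℂ) • (t2 m).l p := by
  obtain ⟨q, hq0, hq, hP⟩ := exists_sqrt_zz hp
  have hr : (p 1 : ℂ) ≠ 0 := by exact_mod_cast (r_pos hp).ne'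
  have hq' : (q : ℂ) ≠ 0 := by exact_mod_cast hq0.ne'
  funext a
  simp only [covD, sum_christoffel_g2 m hp, dirD_t2_n, pd_t2_m m hp,
    Pi.smul_apply, smul_eq_mul]
  fin_cases a <;>
    simp only [t2_l_apply, t2_n_apply, t2_m_apply, dZ_apply, Fin.zero_eta, Fin.mk_one,
      Fin.reduceFinMk, vec4_apply, hq, hP] <;>
    push_cast
  all_goals
    field_simp
    try ring

theorem covD_n_mb (m : ℝ) {p : Pt} (hp : p ∈ domain) :
    covD (g2 m) (t2 m).n (t2 m).mb p = -(3 * P2 p / (2 * p 1) : ℂ) • (t2 m).l p := by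
  obtain ⟨q, hq0, hq, hP⟩ := exists_sqrt_zz hp
  have hr : (p 1 : ℂ) ≠ 0 := by exact_mod_cast (r_pos hp).ne'
  have hq' : (q : ℂ) ≠ 0 := by exact_mod_cast hq0.ne'
  funext a
  simp only [covD, sum_christoffel_g2 m hp, dirD_t2_n, pd_t2_mb m hp,
    Pi.smul_apply, smul_eq_mul]
  fin_cases a <;>
    simp only [t2_l_apply, t2_n_apply, t2_mb_apply, dZb_apply, Fin.zero_eta, Fin.mk_one,
      Fin.reduceFinMk, vec4_apply, hq, hP] <;>
    push_cast
  all_goals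
    field_simp
    try ring

theorem covD_m_l (m : ℝ) {p : Pt} (hp : p ∈ domain) :
    covD (g2 m) (t2 m).m (t2 m).l p = (1 / p 1 : ℂ) • (t2 m).m p := by
  obtain ⟨q, hq0, hq, hP⟩ := exists_sqrt_zz hp
  have hr : (p 1 : ℂ) ≠ 0 := by exact_mod_cast (r_pos hp).ne'
  have hq' : (q : ℂ) ≠ 0 := by exact_mod_cast hq0.ne'
  funext a
  simp only [covD, sum_christoffel_g2 m hp, dirD_t2_m, pd_t2_l,
    Pi.smul_apply, smul_eq_mul]
  fin_cases a <;>
    simp only [t2_l_apply, t2_m_apply, Fin.zero_eta, Fin.mk_one,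
      Fin.reduceFinMk, vec4_apply, hq, hP] <;>
    push_cast
  all_goals
    field_simp
    try ring

theorem covD_m_n (m : ℝ) {p : Pt} (hp : p ∈ domain) :
    covD (g2 m) (t2 m).m (t2 m).n p = -(H2 m p / p 1 : ℂ) • (t2 m).m p := by
  obtain ⟨q, hq0, hq, hP⟩ := exists_sqrt_zz hp
  have hr : (p 1 : ℂ) ≠ 0 := by exact_mod_cast (r_pos hp).ne'
  have hq' : (q : ℂ) ≠ 0 := by exact_mod_cast hq0.ne'
  funext a
  simp only [covD, sum_christoffel_g2 m hp, dirD_t2_m, pd_t2_n m hp,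
    Pi.smul_apply, smul_eq_mul]
  fin_cases a <;>
    simp only [t2_n_apply, t2_m_apply, dR_apply, Fin.zero_eta, Fin.mk_one,
      Fin.reduceFinMk, vec4_apply, hq, hP] <;>
    push_cast
  all_goals
    field_simp
    try ring

theorem covD_m_m (m : ℝ) {p : Pt} (hp : p ∈ domain) :
    covD (g2 m) (t2 m).m (t2 m).m p = -(3 * P2 p / (2 * p 1 * zz p) : ℂ) • (t2 m).m p := by
  obtain ⟨q, hq0, hq, hP⟩ := exists_sqrt_zz hp
  have hr : (p 1 : ℂ) ≠ 0 := by exact_mod_cast (r_pos hp).ne'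
  have hq' : (q : ℂ) ≠ 0 := by exact_mod_cast hq0.ne'
  have hI := Complex.I_sq
  funext a
  simp only [covD, sum_christoffel_g2 m hp, dirD_t2_m, pd_t2_m m hp,
    Pi.smul_apply, smul_eq_mul]
  fin_cases a <;>
    simp only [t2_m_apply, dZ_apply, Fin.zero_eta, Fin.mk_one,
      Fin.reduceFinMk, vec4_apply, hq, hP] <;>
    push_cast
  · linear_combination (norm := skip) (1 / (2 * p 1) : ℂ) * hI
    field_simp
    ring
  · linear_combination (norm := skip) (-H2 m p / p 1 : ℂ) * hI
    field_simp
    ring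
  · linear_combination (norm := skip) (3 * q ^ 4 / (4 * p 1 ^ 2) : ℂ) * hI
    field_simp
    ring
  · linear_combination (norm := skip) (0 : ℂ) * hI
    field_simp
    ring

theorem covD_m_mb (m : ℝ) {p : Pt} (hp : p ∈ domain) :
    covD (g2 m) (t2 m).m (t2 m).mb p = (3 * P2 p / (2 * p 1 * zz p) : ℂ) • (t2 m).mb p
      + (1 / p 1 : ℂ) • ((t2 m).n p - (H2 m p : ℂ) • (t2 m).l p) := by
  obtain ⟨q, hq0, hq, hP⟩ := exists_sqrt_zz hp
  have hr : (p 1 : ℂ) ≠ 0 := by exact_mod_cast (r_pos hp).ne'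
  have hq' : (q : ℂ) ≠ 0 := by exact_mod_cast hq0.ne'
  have hI := Complex.I_sq
  funext a
  simp only [covD, sum_christoffel_g2 m hp, dirD_t2_m, pd_t2_mb m hp,
    Pi.add_apply, Pi.sub_apply, Pi.smul_apply, smul_eq_mul]
  fin_cases a <;>
    simp only [t2_l_apply, t2_n_apply, t2_m_apply, t2_mb_apply, dZb_apply, Fin.zero_eta, Fin.mk_one,
      Fin.reduceFinMk, vec4_apply, hq, hP] <;>
    push_cast
  · linear_combination (norm := skip) (-1 / (2 * p 1) : ℂ) * hI
    field_simp
    ring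
  · linear_combination (norm := skip) (H2 m p / p 1 : ℂ) * hI
    field_simp
    ring
  · linear_combination (norm := skip) (-3 * q ^ 4 / (4 * p 1 ^ 2) : ℂ) * hI
    field_simp
    ring
  · linear_combination (norm := skip) (0 : ℂ) * hI
    field_simp
    ring

theorem covD_mb_l (m : ℝ) {p : Pt} (hp : p ∈ domain) :
    covD (g2 m) (t2 m).mb (t2 m).l p = (1 / p 1 : ℂ) • (t2 m).mb p := by
  obtain ⟨q, hq0, hq, hP⟩ := exists_sqrt_zz hp
  have hr : (p 1 : ℂ) ≠ 0 := by exact_mod_cast (r_pos hp).ne'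
  have hq' : (q : ℂ) ≠ 0 := by exact_mod_cast hq0.ne'
  funext a
  simp only [covD, sum_christoffel_g2 m hp, dirD_t2_mb, pd_t2_l,
    Pi.smul_apply, smul_eq_mul]
  fin_cases a <;>
    simp only [t2_l_apply, t2_mb_apply, Fin.zero_eta, Fin.mk_one,
      Fin.reduceFinMk, vec4_apply, hq, hP] <;>
    push_cast
  all_goals
    field_simp
    try ring

theorem covD_mb_n (m : ℝ) {p : Pt} (hp : p ∈ domain) :
    covD (g2 m) (t2 m).mb (t2 m).n p = -(H2 m p / p 1 : ℂ) • (t2 m).mb p := by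
  obtain ⟨q, hq0, hq, hP⟩ := exists_sqrt_zz hp
  have hr : (p 1 : ℂ) ≠ 0 := by exact_mod_cast (r_pos hp).ne'
  have hq' : (q : ℂ) ≠ 0 := by exact_mod_cast hq0.ne'
  funext a
  simp only [covD, sum_christoffel_g2 m hp, dirD_t2_mb, pd_t2_n m hp,
    Pi.smul_apply, smul_eq_mul]
  fin_cases a <;>
    simp only [t2_n_apply, t2_mb_apply, dR_apply, Fin.zero_eta, Fin.mk_one,
      Fin.reduceFinMk, vec4_apply, hq, hP] <;>
    push_cast
  all_goals
    field_simp
    try ring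

theorem covD_mb_mb (m : ℝ) {p : Pt} (hp : p ∈ domain) :
    covD (g2 m) (t2 m).mb (t2 m).mb p = -(3 * P2 p / (2 * p 1 * zz p) : ℂ) • (t2 m).mb p := by
  obtain ⟨q, hq0, hq, hP⟩ := exists_sqrt_zz hp
  have hr : (p 1 : ℂ) ≠ 0 := by exact_mod_cast (r_pos hp).ne'
  have hq' : (q : ℂ) ≠ 0 := by exact_mod_cast hq0.ne'
  have hI := Complex.I_sq
  funext a
  simp only [covD, sum_christoffel_g2 m hp, dirD_t2_mb, pd_t2_mb m hp,
    Pi.smul_apply, smul_eq_mul]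
  fin_cases a <;>
    simp only [t2_mb_apply, dZb_apply, Fin.zero_eta, Fin.mk_one,
      Fin.reduceFinMk, vec4_apply, hq, hP] <;>
    push_cast
  · linear_combination (norm := skip) (1 / (2 * p 1) : ℂ) * hI
    field_simp
    ring
  · linear_combination (norm := skip) (-H2 m p / p 1 : ℂ) * hI
    field_simp
    ring
  · linear_combination (norm := skip) (3 * q ^ 4 / (4 * p 1 ^ 2) : ℂ) * hI
    field_simp
    ring
  · linear_combination (norm := skip) (0 : ℂ) * hI
    field_simp
    ring

theorem covD_mb_m (m : ℝ) {p : Pt} (hp : p ∈ domain) :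
    covD (g2 m) (t2 m).mb (t2 m).m p = (3 * P2 p / (2 * p 1 * zz p) : ℂ) • (t2 m).m p
      + (1 / p 1 : ℂ) • ((t2 m).n p - (H2 m p : ℂ) • (t2 m).l p) := by
  obtain ⟨q, hq0, hq, hP⟩ := exists_sqrt_zz hp
  have hr : (p 1 : ℂ) ≠ 0 := by exact_mod_cast (r_pos hp).ne'
  have hq' : (q : ℂ) ≠ 0 := by exact_mod_cast hq0.ne'
  have hI := Complex.I_sq
  funext a
  simp only [covD, sum_christoffel_g2 m hp, dirD_t2_mb, pd_t2_m m hp,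
    Pi.add_apply, Pi.sub_apply, Pi.smul_apply, smul_eq_mul]
  fin_cases a <;>
    simp only [t2_l_apply, t2_n_apply, t2_m_apply, t2_mb_apply, dZ_apply, Fin.zero_eta, Fin.mk_one,
      Fin.reduceFinMk, vec4_apply, hq, hP] <;>
    push_cast
  · linear_combination (norm := skip) (-1 / (2 * p 1) : ℂ) * hI
    field_simp
    ring
  · linear_combination (norm := skip) (H2 m p / p 1 : ℂ) * hI
    field_simp
    ring
  · linear_combination (norm := skip) (-3 * q ^ 4 / (4 * p 1 ^ 2) : ℂ) * hI
    field_simp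
    ring
  · linear_combination (norm := skip) (0 : ℂ) * hI
    field_simp
    ring

/-! ### The projected Killing vector -/

theorem ip_add (g : Metric) (p : Pt) (u v w : CVec) : ip g p u (v + w) = ip g p u v + ip g p u w := by
  simp only [ip, Pi.add_apply, mul_add, Finset.sum_add_distrib]

theorem ip_smul (g : Metric) (p : Pt) (k : ℂ) (u v : CVec) : ip g p u (k • v) = k * ip g p u v := by
  simp only [ip, Pi.smul_apply, smul_eq_mul, Finset.mul_sum]
  exact Finset.sum_congr rfl fun a _ => Finset.sum_congr rfl fun b _ => by ring

theorem ip_sub (g : Metric) (p : Pt) (u v w : CVec) : ip g p u (v - w) = ip g p u v - ip g p u w := by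
  simp only [ip, Pi.sub_apply, mul_sub, Finset.sum_sub_distrib]

theorem ip_zero (g : Metric) (p : Pt) (u : CVec) : ip g p u 0 = 0 := by
  simp [ip]

/-- All sixteen products of the tetrad vectors. -/
theorem ip_t2 (m : ℝ) {p : Pt} (hp : p ∈ domain) :
    (ip (g2 m) p ((t2 m).l p) ((t2 m).l p) = 0 ∧ ip (g2 m) p ((t2 m).l p) ((t2 m).n p) = 1 ∧
      ip (g2 m) p ((t2 m).l p) ((t2 m).m p) = 0 ∧ ip (g2 m) p ((t2 m).l p) ((t2 m).mb p) = 0) ∧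
    (ip (g2 m) p ((t2 m).n p) ((t2 m).l p) = 1 ∧ ip (g2 m) p ((t2 m).n p) ((t2 m).n p) = 0 ∧
      ip (g2 m) p ((t2 m).n p) ((t2 m).m p) = 0 ∧ ip (g2 m) p ((t2 m).n p) ((t2 m).mb p) = 0) ∧
    (ip (g2 m) p ((t2 m).m p) ((t2 m).l p) = 0 ∧ ip (g2 m) p ((t2 m).m p) ((t2 m).n p) = 0 ∧
      ip (g2 m) p ((t2 m).m p) ((t2 m).m p) = 0 ∧ ip (g2 m) p ((t2 m).m p) ((t2 m).mb p) = -1) ∧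
    (ip (g2 m) p ((t2 m).mb p) ((t2 m).l p) = 0 ∧ ip (g2 m) p ((t2 m).mb p) ((t2 m).n p) = 0 ∧
      ip (g2 m) p ((t2 m).mb p) ((t2 m).m p) = -1 ∧
      ip (g2 m) p ((t2 m).mb p) ((t2 m).mb p) = 0) := by
  have comm : ∀ v w, ip (g2 m) p v w = ip (g2 m) p w v := fun v w => by
    simp only [ip_g2]; ring
  obtain ⟨-, -, -, h1, h2, h3, h4, h5, h6, h7, h8, h9, h10⟩ := isNullAt_t2 m hp
  rw [comm ((t2 m).n p) ((t2 m).l p), comm ((t2 m).m p) ((t2 m).l p),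
    comm ((t2 m).mb p) ((t2 m).l p), comm ((t2 m).m p) ((t2 m).n p),
    comm ((t2 m).mb p) ((t2 m).n p), comm ((t2 m).mb p) ((t2 m).m p)]
  exact ⟨⟨h3, h1, h7, h8⟩, ⟨h1, h4, h9, h10⟩, ⟨h7, h9, h5, h2⟩, ⟨h8, h10, h2, h6⟩⟩

theorem rho_g2 (m : ℝ) {p : Pt} (hp : p ∈ domain) : rho (g2 m) (t2 m) p = -(1 / p 1 : ℂ) := by
  simp only [rho, covD_mb_l m hp, ip_smul, ip_t2 m hp]
  ring

theorem tau_g2 (m : ℝ) {p : Pt} (hp : p ∈ domain) : tau (g2 m) (t2 m) p = 0 := by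
  simp only [tau, covD_n_l m hp, ip_smul, ip_t2 m hp, mul_zero]

theorem rho'_g2 (m : ℝ) {p : Pt} (hp : p ∈ domain) :
    rho' (g2 m) (t2 m) p = (H2 m p / p 1 : ℂ) := by
  simp only [rho', covD_m_n m hp, ip_smul, ip_t2 m hp]
  ring

theorem tau'_g2 (m : ℝ) {p : Pt} (hp : p ∈ domain) : tau' (g2 m) (t2 m) p = 0 := by
  simp only [tau', covD_l_n m hp, ip_zero]

theorem epsilonSC_g2 (m : ℝ) {p : Pt} (hp : p ∈ domain) : epsilonSC (g2 m) (t2 m) p = 0 := by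
  simp only [epsilonSC, covD_l_l m hp, covD_l_mb m hp, ip_zero, add_zero, mul_zero]

theorem betaSC_g2 (m : ℝ) {p : Pt} (hp : p ∈ domain) :
    betaSC (g2 m) (t2 m) p = -(3 * P2 p / (4 * p 1 * zz p) : ℂ) := by
  simp only [betaSC, covD_m_l m hp, covD_m_mb m hp, ip_add, ip_sub, ip_smul, ip_t2 m hp]
  ring

theorem pd_psi3 (m : ℝ) {p : Pt} (hp : p ∈ domain) (i : Fin 4) :
    pd i (Psi (g2 m) (t2 m) 3) p =
      ((![0, -2 * P2 p / p 1 ^ 3, 3 * P2 p / (zz p * p 1 ^ 2), 0] i : ℝ) : ℂ) * (3 / 2) := by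
  have h : HasGrad (fun q => P2 q / q 1 ^ 2) (-2 * P2 p / p 1 ^ 3)
      (3 * P2 p / (zz p * p 1 ^ 2)) p := by
    refine (hasGrad_P2_mul_zpow (-2) hp).congr (fun q => ?_) ?_ ?_ <;>
      norm_num [zpow_neg, zpow_ofNat] <;> ring
  rw [← h.pd_ofReal_mul (3 / 2) i]
  refine pd_congr hp (fun q hq => ?_) i
  rw [psi3_g2 m hq]
  simp only [P2]
  push_cast
  ring

theorem psi3_g2' (m : ℝ) {p : Pt} (hp : p ∈ domain) :
    Psi (g2 m) (t2 m) 3 p = (3 / 2 * P2 p / p 1 ^ 2 : ℂ) := by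
  rw [psi3_g2 m hp]
  simp only [P2]
  push_cast
  ring

theorem t2_n_add (m : ℝ) (p : Pt) : (t2 m).n p + (H2 m p : ℂ) • (t2 m).l p = dU := by
  simp [t2, rtTetrad]

theorem ne_zero_of_cube {m : ℝ} (hm : m ≠ 0) {c : ℂ} (hc : c ^ 3 = -m) : c ≠ 0 := by
  rintro rfl
  apply hm
  rw [zero_pow three_ne_zero, eq_comm, neg_eq_zero] at hc
  exact_mod_cast hc

/-- The two multiples of `∂_u` and `P² ∂_ζ` combine to the vector field `X2`. -/
theorem smul_X2 {m : ℝ} (hm : m ≠ 0) {c : ℂ} (hc : c ^ 3 = -m) {p : Pt} (hp : p ∈ domain) :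
    (3 / (2 * c)) • ((t2 m).n p + (H2 m p : ℂ) • (t2 m).l p)
      - (3 * P2 p * p 1 / (2 * c ^ 4)) • (t2 m).m p = (-3 * c ^ 2 / (2 * m ^ 2)) • X2 m p := by
  have hr : (p 1 : ℂ) ≠ 0 := by exact_mod_cast (r_pos hp).ne'
  have hP : (P2 p : ℂ) ^ 2 = zz p ^ 3 := by exact_mod_cast P2_sq hp
  have hc0 := ne_zero_of_cube hm hc
  have hm3 : (m : ℂ) = -c ^ 3 := by linear_combination hc
  have e : (t2 m).m p = (P2 p / p 1 : ℂ) • dZ := by simp [t2, rtTetrad]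
  rw [t2_n_add, X2, smul_add, smul_smul, e, smul_smul, smul_smul, sub_eq_add_neg, ← neg_smul,
    add_comm]
  congr 2
  · push_cast
    rw [hm3, ← hP]
    field_simp
  · rw [hm3]
    field_simp

theorem projKVGHP_g2 {m : ℝ} (hm : m ≠ 0) {ψ : Pt → ℂ} {c : ℂ} (hc : c ^ 3 = -m)
    (hψ : ∀ p ∈ domain, ψ p = c / p 1) {p : Pt} (hp : p ∈ domain) :
    projKVGHP (g2 m) (t2 m) ψ p = (-3 * c ^ 2 / (2 * m ^ 2)) • X2 m p := by
  have hr : (p 1 : ℂ) ≠ 0 := by exact_mod_cast (r_pos hp).ne'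
  have hs : (zz p : ℂ) ≠ 0 := by exact_mod_cast (zz_pos hp).ne'
  have hc0 := ne_zero_of_cube hm hc
  rw [← smul_X2 hm hc hp]
  simp only [projKVGHP, edt, tho, rho_g2 m hp, tau_g2 m hp, rho'_g2 m hp, tau'_g2 m hp,
    epsilonSC_g2 m hp, betaSC_g2 m hp, dirD_t2_l, dirD_t2_m, pd_psi3 m hp, vec4_apply,
    psi3_g2' m hp, hψ p hp]
  have e1 : ((P2 p / p 1 : ℝ) : ℂ) / 2 * (((3 * P2 p / (zz p * p 1 ^ 2) : ℝ) : ℂ) * (3 / 2)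
      - Complex.I * (((0 : ℝ) : ℂ) * (3 / 2)))
      - ((-2 : ℤ) : ℂ) * -(3 * P2 p / (4 * p 1 * zz p) : ℂ) * (3 / 2 * P2 p / p 1 ^ 2 : ℂ)
      - 4 * 0 * (3 / 2 * P2 p / p 1 ^ 2 : ℂ) = 0 := by
    push_cast
    field_simp
    ring
  have e2 : ((-2 * P2 p / p 1 ^ 3 : ℝ) : ℂ) * (3 / 2)
      - ((-2 : ℤ) : ℂ) * 0 * (3 / 2 * P2 p / p 1 ^ 2 : ℂ)
      - 4 * -(1 / p 1 : ℂ) * (3 / 2 * P2 p / p 1 ^ 2 : ℂ) = (3 * P2 p / p 1 ^ 3 : ℂ) := by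
    push_cast
    field_simp
    ring
  rw [e1, e2]
  have e3 : (3 * P2 p / p 1 ^ 3 : ℂ) / (2 * (c / p 1) ^ 4) = 3 * P2 p * p 1 / (2 * c ^ 4) := by
    field_simp
  rw [e3]
  funext a
  simp only [Pi.add_apply, Pi.sub_apply, Pi.smul_apply, smul_eq_mul]
  field_simp
  ring

theorem frame_apply (t : Tetrad) :
    frame t 0 0 = t.l ∧ frame t 0 1 = t.m ∧ frame t 1 0 = t.mb ∧ frame t 1 1 = t.n :=
  ⟨rfl, rfl, rfl, rfl⟩

theorem eps_apply : eps 0 0 = 0 ∧ eps 0 1 = 1 ∧ eps 1 0 = -1 ∧ eps 1 1 = 0 :=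
  ⟨rfl, rfl, rfl, rfl⟩

theorem coframe_apply (g : Metric) (t : Tetrad) (p : Pt) (v : CVec) :
    coframe g t 0 0 p v = ip g p (t.n p) v ∧ coframe g t 0 1 p v = -ip g p (t.mb p) v ∧
    coframe g t 1 0 p v = -ip g p (t.m p) v ∧ coframe g t 1 1 p v = ip g p (t.l p) v := by
  simp [coframe, Fin.sum_univ_two, eps_apply, frame_apply]

theorem spinConn_l (m : ℝ) {p : Pt} (hp : p ∈ domain) (B C : Fin 2) :
    spinConn (g2 m) (t2 m) (t2 m).l B C p = 0 := by
  fin_cases B <;> fin_cases C <;>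
    simp [spinConn, Fin.sum_univ_two, frame_apply, coframe_apply, covD_l_l m hp, covD_l_n m hp,
      covD_l_m m hp, covD_l_mb m hp, ip_zero]

theorem spinConn_n (m : ℝ) {p : Pt} (hp : p ∈ domain) :
    spinConn (g2 m) (t2 m) (t2 m).n 0 0 p = (m / (2 * p 1 ^ 2) : ℂ) ∧
    spinConn (g2 m) (t2 m) (t2 m).n 0 1 p = 0 ∧
    spinConn (g2 m) (t2 m) (t2 m).n 1 0 p = -(3 * P2 p / (2 * p 1) : ℂ) ∧
    spinConn (g2 m) (t2 m) (t2 m).n 1 1 p = -(m / (2 * p 1 ^ 2) : ℂ) := by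
  simp only [spinConn, Fin.sum_univ_two, frame_apply, coframe_apply, covD_n_l m hp,
    covD_n_n m hp, covD_n_m m hp, covD_n_mb m hp, ip_add, ip_sub, ip_smul, ip_t2 m hp]
  and_intros <;> ring

theorem spinConn_m (m : ℝ) {p : Pt} (hp : p ∈ domain) :
    spinConn (g2 m) (t2 m) (t2 m).m 0 0 p = -(3 * P2 p / (4 * p 1 * zz p) : ℂ) ∧
    spinConn (g2 m) (t2 m) (t2 m).m 0 1 p = 0 ∧
    spinConn (g2 m) (t2 m) (t2 m).m 1 0 p = -(H2 m p / p 1 : ℂ) ∧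
    spinConn (g2 m) (t2 m) (t2 m).m 1 1 p = (3 * P2 p / (4 * p 1 * zz p) : ℂ) := by
  simp only [spinConn, Fin.sum_univ_two, frame_apply, coframe_apply, covD_m_l m hp,
    covD_m_n m hp, covD_m_m m hp, covD_m_mb m hp, ip_add, ip_sub, ip_smul, ip_t2 m hp]
  and_intros <;> ring

theorem spinConn_mb (m : ℝ) {p : Pt} (hp : p ∈ domain) :
    spinConn (g2 m) (t2 m) (t2 m).mb 0 0 p = (3 * P2 p / (4 * p 1 * zz p) : ℂ) ∧
    spinConn (g2 m) (t2 m) (t2 m).mb 0 1 p = (1 / p 1 : ℂ) ∧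
    spinConn (g2 m) (t2 m) (t2 m).mb 1 0 p = 0 ∧
    spinConn (g2 m) (t2 m) (t2 m).mb 1 1 p = -(3 * P2 p / (4 * p 1 * zz p) : ℂ) := by
  simp only [spinConn, Fin.sum_univ_two, frame_apply, coframe_apply, covD_mb_l m hp,
    covD_mb_n m hp, covD_mb_m m hp, covD_mb_mb m hp, ip_add, ip_sub, ip_smul, ip_t2 m hp]
  and_intros <;> ring

theorem projKS_g2 (m : ℝ) {ψ : Pt → ℂ} {c : ℂ} (hψ : ∀ p ∈ domain, ψ p = c / p 1) {p : Pt}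
    (hp : p ∈ domain) :
    projKS (g2 m) (t2 m) ψ 0 0 p = 0 ∧
    projKS (g2 m) (t2 m) ψ 0 1 p = (p 1 : ℂ) * (-c⁻¹ / 2) ∧
    projKS (g2 m) (t2 m) ψ 1 0 p = (p 1 : ℂ) * (-c⁻¹ / 2) ∧
    projKS (g2 m) (t2 m) ψ 1 1 p = ((P2 p * p 1 ^ 2 : ℝ) : ℂ) * (-(c ^ 4)⁻¹ / 2) := by
  have hr : (p 1 : ℂ) ≠ 0 := by exact_mod_cast (r_pos hp).ne'
  simp only [projKS, hψ p hp, psi3_g2' m hp, oLow, iotaLow, Matrix.cons_val_zero,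
    Matrix.cons_val_one, inv_div, div_pow]
  push_cast
  refine ⟨by ring, by ring, by ring, ?_⟩
  field_simp
  ring

theorem pd_projKS_g2 (m : ℝ) {ψ : Pt → ℂ} {c : ℂ} (hψ : ∀ p ∈ domain, ψ p = c / p 1) {p : Pt}
    (hp : p ∈ domain) (i : Fin 4) :
    pd i (projKS (g2 m) (t2 m) ψ 0 0) p = 0 ∧
    pd i (projKS (g2 m) (t2 m) ψ 0 1) p = ((![0, 1, 0, 0] i : ℝ) : ℂ) * (-c⁻¹ / 2) ∧
    pd i (projKS (g2 m) (t2 m) ψ 1 0) p = ((![0, 1, 0, 0] i : ℝ) : ℂ) * (-c⁻¹ / 2) ∧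
    pd i (projKS (g2 m) (t2 m) ψ 1 1) p =
      ((![0, 2 * P2 p * p 1, 3 * P2 p * p 1 ^ 2 / zz p, 0] i : ℝ) : ℂ) * (-(c ^ 4)⁻¹ / 2) := by
  have h1 : HasGrad (fun q => q 1) 1 0 p := HasGrad.of_r (hasDerivAt_id (p 1))
  have h2 : HasGrad (fun q => P2 q * q 1 ^ 2) (2 * P2 p * p 1) (3 * P2 p * p 1 ^ 2 / zz p) p := by
    refine (hasGrad_P2_mul_zpow 2 hp).congr (fun q => ?_) ?_ ?_ <;>
      norm_num [zpow_ofNat] <;> ring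
  refine ⟨?_, ?_, ?_, ?_⟩
  · rw [pd_congr hp (fun q hq => (projKS_g2 m hψ hq).1), pd_const]
  · rw [pd_congr hp (fun q hq => (projKS_g2 m hψ hq).2.1), h1.pd_ofReal_mul]
  · rw [pd_congr hp (fun q hq => (projKS_g2 m hψ hq).2.2.1), h1.pd_ofReal_mul]
  · rw [pd_congr hp (fun q hq => (projKS_g2 m hψ hq).2.2.2), h2.pd_ofReal_mul]

theorem divK_g2 (m : ℝ) {ψ : Pt → ℂ} {c : ℂ} (hc0 : c ≠ 0)
    (hψ : ∀ p ∈ domain, ψ p = c / p 1) {p : Pt} (hp : p ∈ domain) :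
    divK (g2 m) (t2 m) (projKS (g2 m) (t2 m) ψ) 0 0 p = (3 / (2 * c) : ℂ) ∧
    divK (g2 m) (t2 m) (projKS (g2 m) (t2 m) ψ) 0 1 p = 0 ∧
    divK (g2 m) (t2 m) (projKS (g2 m) (t2 m) ψ) 1 0 p = (3 * P2 p * p 1 / (2 * c ^ 4) : ℂ) ∧
    divK (g2 m) (t2 m) (projKS (g2 m) (t2 m) ψ) 1 1 p = (3 / (2 * c) * H2 m p : ℂ) := by
  obtain ⟨q, hq0, hq, hP⟩ := exists_sqrt_zz hp
  have hr : (p 1 : ℂ) ≠ 0 := by exact_mod_cast (r_pos hp).ne'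
  have hq' : (q : ℂ) ≠ 0 := by exact_mod_cast hq0.ne'
  simp only [divK, nablaK, Fin.sum_univ_two, eps_apply, frame_apply, spinConn_l m hp,
    spinConn_n m hp, spinConn_m m hp, spinConn_mb m hp, dirD_t2_l, dirD_t2_n, dirD_t2_m,
    dirD_t2_mb, pd_projKS_g2 m hψ hp, projKS_g2 m hψ hp, vec4_apply, hq, hP]
  push_cast
  and_intros <;> field_simp <;> ring

theorem projKV_g2 {m : ℝ} (hm : m ≠ 0) {ψ : Pt → ℂ} {c : ℂ} (hc : c ^ 3 = -m)
    (hψ : ∀ p ∈ domain, ψ p = c / p 1) {p : Pt} (hp : p ∈ domain) :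
    projKV (g2 m) (t2 m) ψ p = (-3 * c ^ 2 / (2 * m ^ 2)) • X2 m p := by
  rw [← smul_X2 hm hc hp]
  simp only [projKV, Fin.sum_univ_two, eps_apply, frame_apply,
    divK_g2 m (ne_zero_of_cube hm hc) hψ hp]
  funext a
  simp only [Pi.add_apply, Pi.sub_apply, Pi.smul_apply, smul_eq_mul]
  ring

/-! ### Petrov types -/

theorem weylQuartic_eq_iff (Ψ : Fin 5 → ℂ) (α β γ : Fin 2 → ℂ) :
    (∀ x y, weylQuartic Ψ x y
      = (α 0 * x + α 1 * y) ^ 2 * (β 0 * x + β 1 * y) * (γ 0 * x + γ 1 * y)) ↔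
    Ψ 0 = α 0 ^ 2 * (β 0 * γ 0) ∧
    4 * Ψ 1 = α 0 ^ 2 * (β 0 * γ 1 + β 1 * γ 0) + 2 * α 0 * α 1 * (β 0 * γ 0) ∧
    6 * Ψ 2 = α 0 ^ 2 * (β 1 * γ 1) + 2 * α 0 * α 1 * (β 0 * γ 1 + β 1 * γ 0)
      + α 1 ^ 2 * (β 0 * γ 0) ∧
    4 * Ψ 3 = 2 * α 0 * α 1 * (β 1 * γ 1) + α 1 ^ 2 * (β 0 * γ 1 + β 1 * γ 0) ∧
    Ψ 4 = α 1 ^ 2 * (β 1 * γ 1) := by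
  unfold weylQuartic
  constructor
  · intro h
    have h0 := h 1 0
    have h4 := h 0 1
    have h1 := h 1 1
    have h2 := h 1 (-1)
    have h3 := h 2 1
    refine ⟨by linear_combination h0, ?_, by linear_combination h1 / 2 + h2 / 2 - h0 - h4, ?_,
      by linear_combination h4⟩
    · linear_combination h3 / 6 - h1 / 2 - h2 / 6 - 2 * h0 + h4 / 2
    · linear_combination h1 - h2 / 3 - h3 / 6 + 2 * h0 - h4 / 2
  · rintro ⟨h0, h1, h2, h3, h4⟩ x y
    linear_combination x ^ 4 * h0 + x ^ 3 * y * h1 + x ^ 2 * y ^ 2 * h2 + x * y ^ 3 * h3 + y ^ 4 * h4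

theorem isTypeII_iff {Ψ : Fin 5 → ℂ} (h0 : Ψ 0 = 0) (h1 : Ψ 1 = 0) (h2 : Ψ 2 ≠ 0) :
    IsTypeII Ψ ↔ 4 * Ψ 3 ^ 2 - 6 * Ψ 2 * Ψ 4 ≠ 0 := by
  simp only [IsTypeII, weylQuartic_eq_iff, h0, h1]
  constructor
  · rintro ⟨α, β, γ, hαβ, hαγ, hβγ, e0, e1, e2, e3, e4⟩
    have hα : α 0 = 0 := by
      by_contra hα
      have hβγ0 : β 0 * γ 0 = 0 := by
        simpa [hα] using e0.symm
      have e1' : β 0 * γ 1 + β 1 * γ 0 = 0 := by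
        rw [hβγ0] at e1
        simpa [hα] using e1.symm
      rcases mul_eq_zero.1 hβγ0 with hb | hc
      · apply hβγ
        linear_combination 2 * γ 1 * hb - e1'
      · apply hβγ
        linear_combination e1' - 2 * β 1 * hc
    rw [hα] at e2 e3 hαβ
    have hα1 : α 1 ≠ 0 := by
      intro h
      apply hαβ
      rw [h]
      ring
    have key : 4 * Ψ 3 ^ 2 - 6 * Ψ 2 * Ψ 4 = (α 1 ^ 2 * (β 0 * γ 1 - β 1 * γ 0) / 2) ^ 2 := by
      rw [e2, e4, show Ψ 3 = (4 * Ψ 3) / 4 by ring, e3]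
      ring
    rw [key]
    exact pow_ne_zero 2 (div_ne_zero (mul_ne_zero (pow_ne_zero 2 hα1) hβγ) two_ne_zero)
  · intro hd
    obtain ⟨δ, hδ⟩ := IsAlgClosed.exists_pow_nat_eq (4 * Ψ 3 ^ 2 - 6 * Ψ 2 * Ψ 4) two_pos
    have hδ0 : δ ≠ 0 := by
      rintro rfl
      apply hd
      rw [← hδ]
      ring
    refine ⟨![0, 1], ![6 * Ψ 2, 2 * Ψ 3 - δ], ![1, (2 * Ψ 3 + δ) / (6 * Ψ 2)], ?_, ?_, ?_, ?_⟩ <;>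
      simp only [Matrix.cons_val_zero, Matrix.cons_val_one]
    · simpa using h2
    · simp
    · have : 6 * Ψ 2 * ((2 * Ψ 3 + δ) / (6 * Ψ 2)) - (2 * Ψ 3 - δ) * 1 = 2 * δ := by
        field_simp
        ring
      rw [this]
      exact mul_ne_zero two_ne_zero hδ0
    · refine ⟨by ring, by ring, by ring, ?_, ?_⟩
      · field_simp
        ring
      · field_simp
        linear_combination hδ

theorem isTypeD_iff {Ψ : Fin 5 → ℂ} (h0 : Ψ 0 = 0) (h1 : Ψ 1 = 0) (h2 : Ψ 2 ≠ 0) :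
    IsTypeD Ψ ↔ 4 * Ψ 3 ^ 2 - 6 * Ψ 2 * Ψ 4 = 0 := by
  have hsq : ∀ α β : Fin 2 → ℂ, (∀ x y, weylQuartic Ψ x y
      = (α 0 * x + α 1 * y) ^ 2 * (β 0 * x + β 1 * y) ^ 2) ↔ ∀ x y, weylQuartic Ψ x y
      = (α 0 * x + α 1 * y) ^ 2 * (β 0 * x + β 1 * y) * (β 0 * x + β 1 * y) := fun α β => by
    simp only [sq, mul_assoc]
  simp only [IsTypeD, hsq, weylQuartic_eq_iff, h0, h1]
  constructor
  · rintro ⟨α, β, -, e0, e1, e2, e3, e4⟩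
    have h : α 0 * β 0 = 0 := by
      rw [← sq_eq_zero_iff]
      linear_combination -e0
    rw [show Ψ 3 = (4 * Ψ 3) / 4 by ring, e2, e3, e4]
    linear_combination -2 * α 1 ^ 3 * β 1 ^ 3 * h
  · intro hd
    obtain ⟨κ, hκ⟩ := IsAlgClosed.exists_pow_nat_eq (6 * Ψ 2) two_pos
    have hκ0 : κ ≠ 0 := by
      rintro rfl
      apply h2
      linear_combination -hκ / 6
    refine ⟨![0, 1], ![κ, 2 * Ψ 3 / κ], ?_, ?_⟩ <;>
      simp only [Matrix.cons_val_zero, Matrix.cons_val_one]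
    · simpa using hκ0
    · refine ⟨by ring, by ring, by linear_combination -hκ, ?_, ?_⟩
      · field_simp
        ring
      · field_simp
        linear_combination Ψ 4 * hκ - hd

theorem discr_g2 (m : ℝ) {p : Pt} (hp : p ∈ domain) :
    4 * Psi (g2 m) (t2 m) 3 p ^ 2 - 6 * Psi (g2 m) (t2 m) 2 p * Psi (g2 m) (t2 m) 4 p
      = ((9 * zz p ^ 2 / p 1 ^ 5 * (p 1 * zz p - 3 * m) : ℝ) : ℂ) := by
  have hr : (p 1 : ℂ) ≠ 0 := by exact_mod_cast (r_pos hp).ne'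
  have hP : (P2 p : ℂ) ^ 2 = zz p ^ 3 := by exact_mod_cast P2_sq hp
  rw [psi2_g2 m hp, psi3_g2' m hp, psi4_g2 m hp, div_pow, mul_pow, hP]
  push_cast
  field_simp
  ring

theorem discr_g2_eq_zero_iff (m : ℝ) {p : Pt} (hp : p ∈ domain) :
    4 * Psi (g2 m) (t2 m) 3 p ^ 2 - 6 * Psi (g2 m) (t2 m) 2 p * Psi (g2 m) (t2 m) 4 p = 0 ↔
      p 1 * zz p = 3 * m := by
  have hr := (r_pos hp).ne'
  have hs := (zz_pos hp).ne'
  rw [discr_g2 m hp, Complex.ofReal_eq_zero, mul_eq_zero, sub_eq_zero, or_iff_right]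
  positivity

theorem psi2_g2_ne_zero {m : ℝ} (hm : m ≠ 0) {p : Pt} (hp : p ∈ domain) :
    Psi (g2 m) (t2 m) 2 p ≠ 0 := by
  have hr := (r_pos hp).ne'
  rw [psi2_g2 m hp, Complex.ofReal_ne_zero]
  exact div_ne_zero (neg_ne_zero.2 hm) (pow_ne_zero 3 hr)

theorem isTypeII_g2_iff {m : ℝ} (hm : m ≠ 0) {p : Pt} (hp : p ∈ domain) :
    IsTypeII (fun i => Psi (g2 m) (t2 m) i p) ↔ p 1 * zz p ≠ 3 * m := by
  rw [isTypeII_iff (Ψ := fun i => Psi (g2 m) (t2 m) i p) (psi0_g2 m hp) (psi1_g2 m hp)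
    (psi2_g2_ne_zero hm hp)]
  exact (discr_g2_eq_zero_iff m hp).not

theorem isTypeD_g2_iff {m : ℝ} (hm : m ≠ 0) {p : Pt} (hp : p ∈ domain) :
    IsTypeD (fun i => Psi (g2 m) (t2 m) i p) ↔ p 1 * zz p = 3 * m := by
  rw [isTypeD_iff (Ψ := fun i => Psi (g2 m) (t2 m) i p) (psi0_g2 m hp) (psi1_g2 m hp)
    (psi2_g2_ne_zero hm hp)]
  exact discr_g2_eq_zero_iff m hp

theorem setOf_isTypeII_g2 {m : ℝ} (hm : m ≠ 0) :
    {p | p ∈ domain ∧ IsTypeII (fun i => Psi (g2 m) (t2 m) i p)} =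
      {p | p ∈ domain ∧ p 1 * zz p ≠ 3 * m} :=
  Set.ext fun _ => and_congr_right fun hp => isTypeII_g2_iff hm hp

theorem continuous_zz : Continuous zz := continuous_const.mul (continuous_apply 2)

theorem isOpen_setOf_ne (m : ℝ) : IsOpen {p | p ∈ domain ∧ p 1 * zz p ≠ 3 * m} :=
  isOpen_domain.inter (isOpen_ne_fun ((continuous_apply 1).mul continuous_zz) continuous_const)

theorem domain_subset_closure (m : ℝ) :
    domain ⊆ closure {p | p ∈ domain ∧ p 1 * zz p ≠ 3 * m} := by
  intro p hp
  by_cases h : p 1 * zz p = 3 * m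
  · have hcont : Continuous fun t : ℝ => Function.update p 1 (p 1 + t) :=
      continuous_const.update 1 (continuous_const.add continuous_id)
    have hlim : Filter.Tendsto (fun t : ℝ => Function.update p 1 (p 1 + t))
        (nhdsWithin 0 (Set.Ioi 0)) (nhds p) := by
      have := hcont.tendsto 0
      simp only [add_zero, Function.update_eq_self] at this
      exact this.mono_left nhdsWithin_le_nhds
    refine mem_closure_of_tendsto hlim ?_
    filter_upwards [self_mem_nhdsWithin] with t ht
    have ht : 0 < t := ht
    have hz : zz (Function.update p 1 (p 1 + t)) = zz p := by simp [zz]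
    refine ⟨⟨?_, ?_⟩, ?_⟩
    · simpa using add_pos (r_pos hp) ht
    · change 0 < zz (Function.update p 1 (p 1 + t))
      rw [hz]
      exact zz_pos hp
    · rw [hz, Function.update_self]
      have := mul_pos ht (zz_pos hp)
      intro h'
      linarith [add_mul (p 1) t (zz p)]
  · exact subset_closure ⟨hp, h⟩

/-! ### Branches of the cube root -/

theorem convex_domain : Convex ℝ domain := by
  intro p hp q hq a b ha hb hab
  obtain ⟨hp1, hp2⟩ := hp
  obtain ⟨hq1, hq2⟩ := hq
  have key : ∀ x y : ℝ, 0 < x → 0 < y → 0 < a * x + b * y := fun x y hx hy =>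
    (convex_Ioi (0 : ℝ)) hx hy ha hb hab
  refine ⟨?_, ?_⟩
  · simpa using key _ _ hp1 hq1
  · have := key _ _ hp2 hq2
    simp only [Pi.add_apply, Pi.smul_apply, smul_eq_mul]
    linarith

theorem exists_branch {m : ℝ} {ψ : Pt → ℂ} (hψ : ContinuousOn ψ domain)
    (h3 : ∀ p ∈ domain, ψ p ^ 3 = Psi (g2 m) (t2 m) 2 p) :
    ∃ c : ℂ, c ^ 3 = -m ∧ ∀ p ∈ domain, ψ p = c / p 1 := by
  have hfin : {z : ℂ | z ^ 3 = -m}.Finite := by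
    refine (Polynomial.nthRoots 3 (-m : ℂ)).toFinset.finite_toSet.subset fun z hz => ?_
    simpa [Polynomial.mem_nthRoots] using hz
  have hcont : ContinuousOn (fun p : Pt => ψ p * (p 1 : ℂ)) domain :=
    hψ.mul (Complex.continuous_ofReal.comp (continuous_apply 1)).continuousOn
  have hmaps : Set.MapsTo (fun p : Pt => ψ p * (p 1 : ℂ)) domain {z : ℂ | z ^ 3 = -m} := by
    intro p hp
    have hr : (p 1 : ℂ) ≠ 0 := by exact_mod_cast (r_pos hp).ne'
    simp only [Set.mem_ofPred_eq, mul_pow, h3 p hp, psi2_g2 m hp]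
    push_cast
    field_simp
  have h0 : (![0, 1, 1, 0] : Pt) ∈ domain := by
    constructor <;> simp
  refine ⟨_, hmaps h0, fun p hp => ?_⟩
  have hr : (p 1 : ℂ) ≠ 0 := by exact_mod_cast (r_pos hp).ne'
  rw [eq_div_iff hr]
  exact convex_domain.isPreconnected.constant_of_mapsTo hfin.isDiscrete hcont hmaps hp h0

theorem cpow_third_div_cube {a r : ℝ} (ha : 0 ≤ a) (hr : 0 < r) :
    ((a / r ^ 3 : ℝ) : ℂ) ^ (1 / 3 : ℂ) = (a : ℂ) ^ (1 / 3 : ℂ) / r := by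
  have h3 : (1 / 3 : ℂ) = ((1 / 3 : ℝ) : ℂ) := by push_cast; rfl
  rw [h3, ← Complex.ofReal_cpow (by positivity), ← Complex.ofReal_cpow ha, ← Complex.ofReal_div,
    Real.div_rpow ha (by positivity)]
  congr 2
  rw [← Real.rpow_natCast, ← Real.rpow_mul hr.le]
  norm_num

theorem cpow_third_pow (x : ℂ) : (x ^ (1 / 3 : ℂ)) ^ 3 = x := by
  rw [← Complex.cpow_nat_mul]
  norm_num

end RT

end

theorem robinson_trautman_typeII (m : ℝ) (hm : m ≠ 0) :
    -- the metric is the Robinson–Trautman metric of `P`, `H`, with `l, n, m, m̄` as null tetrad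
    (∀ p ∈ RT.domain, RT.g2 m p = RT.rtMetric RT.P2 (RT.H2 m) p ∧ (RT.t2 m).IsNullAt (RT.g2 m) p) ∧
    -- it is Ricci-flat
    (∀ p ∈ RT.domain, ∀ a b, RT.ricci (RT.g2 m) a b p = 0) ∧
    -- Weyl scalars
    (∀ p ∈ RT.domain,
      RT.Psi (RT.g2 m) (RT.t2 m) 0 p = 0 ∧
      RT.Psi (RT.g2 m) (RT.t2 m) 1 p = 0 ∧
      RT.Psi (RT.g2 m) (RT.t2 m) 2 p = ((-m / p 1 ^ 3 : ℝ) : ℂ) ∧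
      RT.Psi (RT.g2 m) (RT.t2 m) 3 p = ((3 / 2 * RT.zz p ^ (3 / 2 : ℝ) / p 1 ^ 2 : ℝ) : ℂ) ∧
      RT.Psi (RT.g2 m) (RT.t2 m) 4 p = ((-(9 / 2) * RT.zz p ^ 2 / p 1 ^ 2 : ℝ) : ℂ)) ∧
    -- Petrov type II off the hypersurface `r (ζ + ζ̄) = 3 m`, where the type is D; the points of
    -- type II are open and dense in the domain
    (∀ p ∈ RT.domain,
      (RT.IsTypeII (fun i => RT.Psi (RT.g2 m) (RT.t2 m) i p) ↔ p 1 * RT.zz p ≠ 3 * m) ∧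
      (RT.IsTypeD (fun i => RT.Psi (RT.g2 m) (RT.t2 m) i p) ↔ p 1 * RT.zz p = 3 * m)) ∧
    IsOpen {p | p ∈ RT.domain ∧ RT.IsTypeII (fun i => RT.Psi (RT.g2 m) (RT.t2 m) i p)} ∧
    RT.domain ⊆
      closure {p | p ∈ RT.domain ∧ RT.IsTypeII (fun i => RT.Psi (RT.g2 m) (RT.t2 m) i p)} ∧
    -- the projected Killing vector, for every continuous branch `ψ` of `Ψ₂^{1/3}`;
    -- `w` and `μ` are the cube roots `(-1)^{1/3}` and `m^{1/3}` that belong to this branch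
    (∀ ψ : RT.Pt → ℂ, ContinuousOn ψ RT.domain →
      (∀ p ∈ RT.domain, ψ p ^ 3 = RT.Psi (RT.g2 m) (RT.t2 m) 2 p) →
      ∃ w μ : ℂ, w ^ 3 = -1 ∧ μ ^ 3 = (m : ℂ) ∧ ∀ p ∈ RT.domain,
        ψ p = w * μ / (p 1 : ℂ) ∧
        RT.projKV (RT.g2 m) (RT.t2 m) ψ p = (-3 * w ^ 2 / (2 * μ ^ 4)) • RT.X2 m p ∧
        RT.projKVGHP (RT.g2 m) (RT.t2 m) ψ p = (-3 * w ^ 2 / (2 * μ ^ 4)) • RT.X2 m p) ∧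
    -- in particular for the principal branch
    (0 < m → ∀ p ∈ RT.domain,
      RT.projKV (RT.g2 m) (RT.t2 m)
          (fun q => RT.Psi (RT.g2 m) (RT.t2 m) 2 q ^ (1 / 3 : ℂ)) p
        = (-3 * (-1 : ℂ) ^ (2 / 3 : ℂ) / (2 * (m : ℂ) ^ (4 / 3 : ℂ))) • RT.X2 m p) ∧
    (m < 0 → ∀ p ∈ RT.domain,
      RT.projKV (RT.g2 m) (RT.t2 m)
          (fun q => RT.Psi (RT.g2 m) (RT.t2 m) 2 q ^ (1 / 3 : ℂ)) p
        = (-3 / (2 * (-m : ℂ) ^ (4 / 3 : ℂ))) • RT.X2 m p) := by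
  have hm' : (m : ℂ) ≠ 0 := by exact_mod_cast hm
  have coef : ∀ w μ : ℂ, μ ^ 3 = (m : ℂ) →
      -3 * (w * μ) ^ 2 / (2 * (m : ℂ) ^ 2) = -3 * w ^ 2 / (2 * μ ^ 4) := by
    intro w μ hμ
    have hμ0 : μ ≠ 0 := by
      rintro rfl
      apply hm'
      rw [← hμ]
      ring
    rw [← hμ]
    field_simp
  refine ⟨fun p hp => ⟨RT.g2_eq_rtMetric m hp, RT.isNullAt_t2 m hp⟩,
    fun p hp a b => RT.ricci_g2 m hp a b,
    fun p hp => ⟨RT.psi0_g2 m hp, RT.psi1_g2 m hp, RT.psi2_g2 m hp, RT.psi3_g2 m hp,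
      RT.psi4_g2 m hp⟩,
    fun p hp => ⟨RT.isTypeII_g2_iff hm hp, RT.isTypeD_g2_iff hm hp⟩, ?_, ?_, ?_, ?_, ?_⟩
  · rw [RT.setOf_isTypeII_g2 hm]
    exact RT.isOpen_setOf_ne m
  · rw [RT.setOf_isTypeII_g2 hm]
    exact RT.domain_subset_closure m
  · intro ψ hψ h3
    obtain ⟨c, hc, hψc⟩ := RT.exists_branch hψ h3
    have hw : (-1 : ℂ) ^ 3 = -1 := by norm_num
    have hμ : (-c) ^ 3 = (m : ℂ) := by linear_combination -hc
    have hcw : -1 * -c = c := by ring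
    refine ⟨-1, -c, hw, hμ, fun p hp => ?_⟩
    rw [← coef _ _ hμ, hcw]
    exact ⟨hψc p hp, RT.projKV_g2 hm hc hψc hp, RT.projKVGHP_g2 hm hc hψc hp⟩
  · intro hpos p hp
    have hw := RT.cpow_third_pow (-1)
    have hμ := RT.cpow_third_pow (m : ℂ)
    have e1 : (-1 : ℂ) ^ (2 / 3 : ℂ) = ((-1 : ℂ) ^ (1 / 3 : ℂ)) ^ 2 := by
      rw [← Complex.cpow_nat_mul]
      norm_num
    have e2 : (m : ℂ) ^ (4 / 3 : ℂ) = ((m : ℂ) ^ (1 / 3 : ℂ)) ^ 4 := by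
      rw [← Complex.cpow_nat_mul]
      norm_num
    rw [e1, e2, ← coef _ _ hμ]
    refine RT.projKV_g2 hm (by rw [mul_pow, hw, hμ]; ring) (fun q hq => ?_) hp
    have hr := RT.r_pos hq
    have hneg : -m / q 1 ^ 3 ≤ 0 := div_nonpos_of_nonpos_of_nonneg (by linarith) (by positivity)
    have e3 : (-1 : ℂ) ^ (1 / 3 : ℂ) = Complex.exp (Real.pi * Complex.I * (1 / 3)) := by
      have := Complex.ofReal_cpow_of_nonpos (x := -1) (by norm_num) (1 / 3 : ℂ)
      simpa using this
    rw [RT.psi2_g2 m hq, Complex.ofReal_cpow_of_nonpos hneg, ← Complex.ofReal_neg,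
      show -(-m / q 1 ^ 3) = m / q 1 ^ 3 by ring, RT.cpow_third_div_cube hpos.le hr, e3]
    ring
  · intro hneg p hp
    have hc := RT.cpow_third_pow (-m : ℂ)
    have hc0 := RT.ne_zero_of_cube hm hc
    have e2 : (-m : ℂ) ^ (4 / 3 : ℂ) = ((-m : ℂ) ^ (1 / 3 : ℂ)) ^ 4 := by
      rw [← Complex.cpow_nat_mul]
      norm_num
    rw [RT.projKV_g2 hm hc (fun q hq => ?_) hp, e2]
    · congr 1
      generalize (-m : ℂ) ^ (1 / 3 : ℂ) = c at *
      rw [show (m : ℂ) = -c ^ 3 by rw [hc]; ring]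
      field_simp
    · rw [RT.psi2_g2 m hq, RT.cpow_third_div_cube (by linarith) (RT.r_pos hq), Complex.ofReal_neg]
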